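/- arXiv:2306.06695 — 4 statements merged into one kernel-verified Lean document; each statement's English description precedes it below -/
import Mathlib

section
/- For the convex m-gon P_m (m ≥ 4): every set of m−4 pairwise non-crossing diagonals is contained in exactly two triangulations, and any two triangulations of P_m are joined by a finite sequence of triangulations in which consecutive triangulations share exactly m−4 diagonals. (Thus the arc complex of P_m is an (m−4)-dimensional pseudo-manifold.) -/
/-!
Vertices of the convex `m`-gon `P_m` are identified with `ZMod m` in cyclic order.
Blue is encoded by the Boolean value `true`, red by `false`.
-/

namespace Poly

/-- A diagonal of `P_m`: an unordered pair `{i, j}` of vertices with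
`j - i ≢ 0, 1, -1 (mod m)`. -/
def IsDiag (m : ℕ) (e : Sym2 (ZMod m)) : Prop :=
  ∃ i j : ZMod m, e = s(i, j) ∧ j - i ≠ 0 ∧ j - i ≠ 1 ∧ j - i ≠ -1

/-- `x` lies in the open cyclic interval from `a` to `b` (going in the positive
cyclic direction). -/
def StrictBtw (m : ℕ) (a x b : ZMod m) : Prop :=
  0 < (x - a).val ∧ (x - a).val < (b - a).val

/-- Two diagonals `{a,b}` and `{c,d}` cross: their four endpoints are distinct and
exactly one of `c`, `d` lies in the open cyclic interval from `a` to `b`. -/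
def Cross (m : ℕ) (e f : Sym2 (ZMod m)) : Prop :=
  ∃ a b c d : ZMod m, e = s(a, b) ∧ f = s(c, d) ∧
    a ≠ b ∧ a ≠ c ∧ a ≠ d ∧ b ≠ c ∧ b ≠ d ∧ c ≠ d ∧
    Xor' (StrictBtw m a c b) (StrictBtw m a d b)

/-- A triangulation of `P_m`: a set of `m - 3` pairwise non-crossing diagonals. -/
def IsTriangulation (m : ℕ) (T : Finset (Sym2 (ZMod m))) : Prop :=
  T.card = m - 3 ∧ (∀ e ∈ T, IsDiag m e) ∧
    ∀ e ∈ T, ∀ f ∈ T, e ≠ f → ¬ Cross m e f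

/-- A bicolouring: a function from the vertices to {red, blue} attaining both values
(`true` = blue, `false` = red). -/
def IsBicolouring (m : ℕ) (c : ZMod m → Bool) : Prop :=
  (∃ v, c v = true) ∧ (∃ v, c v = false)

/-- A bicolouring is non-trivial if some diagonal has both endpoints red. -/
def IsNontrivialBicolouring (m : ℕ) (c : ZMod m → Bool) : Prop :=
  IsBicolouring m c ∧ ∃ i j : ZMod m, IsDiag m s(i, j) ∧ c i = false ∧ c j = false

/-- A diagonal is permitted if at least one of its endpoints is blue. -/
def Permitted (m : ℕ) (c : ZMod m → Bool) (e : Sym2 (ZMod m)) : Prop :=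
  ∃ v ∈ e, c v = true

/-- A permissible triangulation: a triangulation all of whose diagonals are permitted. -/
def IsPermissible (m : ℕ) (c : ZMod m → Bool) (T : Finset (Sym2 (ZMod m))) : Prop :=
  IsTriangulation m T ∧ ∀ e ∈ T, Permitted m c e

/-- Two permissible triangulations are joined in the flip graph of permissible
triangulations: there is a finite sequence of permissible triangulations from one to the
other in which consecutive triangulations share exactly `m - 4` diagonals. -/
def PermFlipJoined (m : ℕ) (c : ZMod m → Bool) (T₁ T₂ : Finset (Sym2 (ZMod m))) : Prop :=
  ∃ n : ℕ, ∃ f : Fin (n + 1) → Finset (Sym2 (ZMod m)),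
    f 0 = T₁ ∧ f (Fin.last n) = T₂ ∧ (∀ i, IsPermissible m c (f i)) ∧
    ∀ i : Fin n, (f i.castSucc ∩ f i.succ).card = m - 4


/-- Two triangulations are joined in the flip graph: there is a finite sequence of
triangulations from one to the other in which consecutive triangulations share exactly
`m - 4` diagonals. -/
def FlipJoined (m : ℕ) (T₁ T₂ : Finset (Sym2 (ZMod m))) : Prop :=
  ∃ n : ℕ, ∃ f : Fin (n + 1) → Finset (Sym2 (ZMod m)),
    f 0 = T₁ ∧ f (Fin.last n) = T₂ ∧ (∀ i, IsTriangulation m (f i)) ∧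
    ∀ i : Fin n, (f i.castSucc ∩ f i.succ).card = m - 4

/-! ### Non-crossing arcs on a segment of natural numbers -/

/-- An arc of `{0, …, n}`: a pair `a < b ≤ n` of non-consecutive numbers. -/
def IsArc (n : ℕ) (p : ℕ × ℕ) : Prop := p.1 + 2 ≤ p.2 ∧ p.2 ≤ n

/-- The arc `q` starts strictly inside the arc `p` and ends strictly after it. -/
def Overlap (p q : ℕ × ℕ) : Prop := p.1 < q.1 ∧ q.1 < p.2 ∧ p.2 < q.2

/-- A set of pairwise non-crossing arcs of `{0, …, n}`. -/
def IsNonCrossing (n : ℕ) (S : Finset (ℕ × ℕ)) : Prop :=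
  (∀ p ∈ S, IsArc n p) ∧ ∀ p ∈ S, ∀ q ∈ S, ¬ Overlap p q

/-- A set of pairwise non-crossing arcs to which no arc can be added. -/
def IsMaxNonCrossing (n : ℕ) (S : Finset (ℕ × ℕ)) : Prop :=
  IsNonCrossing n S ∧ ∀ p, IsNonCrossing n (insert p S) → p ∈ S

/-- A pair of consecutive numbers or an arc of `S`. -/
def IsEdge (S : Finset (ℕ × ℕ)) (a b : ℕ) : Prop := b = a + 1 ∨ (a, b) ∈ S

section Arcs

variable {n : ℕ} {S T : Finset (ℕ × ℕ)}

lemma IsNonCrossing.subset (hT : IsNonCrossing n T) (h : S ⊆ T) : IsNonCrossing n S :=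
  ⟨fun p hp => hT.1 p (h hp), fun p hp q hq => hT.2 p (h hp) q (h hq)⟩

lemma IsNonCrossing.insert_arc (hS : IsNonCrossing n S) {a b : ℕ} (hab : a + 2 ≤ b) (hb : b ≤ n)
    (h : ∀ c d, (c, d) ∈ S → ¬ (a < c ∧ c < b ∧ b < d) ∧ ¬ (c < a ∧ a < d ∧ d < b)) :
    IsNonCrossing n (insert (a, b) S) := by
  refine ⟨fun p hp => ?_, fun p hp q hq => ?_⟩
  · rcases Finset.mem_insert.1 hp with rfl | hp
    exacts [⟨hab, hb⟩, hS.1 p hp]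
  · rcases Finset.mem_insert.1 hp with rfl | hp <;> rcases Finset.mem_insert.1 hq with rfl | hq
    · exact fun h => lt_irrefl _ h.1
    · exact (h q.1 q.2 hq).1
    · exact (h p.1 p.2 hp).2
    · exact hS.2 p hp q hq

lemma IsNonCrossing.not_cross (hS : IsNonCrossing n S) {a b c d : ℕ} (hab : IsEdge S a b)
    (hcd : (c, d) ∈ S) : ¬ (a < c ∧ c < b ∧ b < d) ∧ ¬ (c < a ∧ a < d ∧ d < b) := by
  rcases hab with rfl | hab
  · omega
  · exact ⟨hS.2 _ hab _ hcd, hS.2 _ hcd _ hab⟩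

lemma IsNonCrossing.edge_lt (hS : IsNonCrossing n S) {a b : ℕ} (hab : IsEdge S a b) : a < b := by
  rcases hab with rfl | hab
  · omega
  · have := (hS.1 _ hab).1
    dsimp only at this
    omega

lemma IsNonCrossing.exists_maximal (hS : IsNonCrossing n S) :
    ∃ T, S ⊆ T ∧ IsMaxNonCrossing n T := by
  have hfin : {T | IsNonCrossing n T}.Finite := by
    refine (Finset.finite_toSet (Finset.range (n + 1) ×ˢ Finset.range (n + 1)).powerset).subset ?_
    intro T hT
    simp only [Finset.coe_powerset, Set.mem_preimage, Set.mem_powerset_iff, Finset.coe_subset]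
    intro p hp
    have := hT.1 p hp
    simp only [IsArc] at this
    simp only [Finset.mem_product, Finset.mem_range]
    omega
  obtain ⟨T, hST, hT⟩ := hfin.exists_le_maximal hS
  refine ⟨T, hST, hT.prop, fun p hp => ?_⟩
  exact hT.le_of_ge hp (Finset.subset_insert p T) (Finset.mem_insert_self p T)

lemma IsMaxNonCrossing.isEdge (hS : IsMaxNonCrossing n S) {a b : ℕ} (hab : a < b) (hb : b ≤ n)
    (h : ∀ c d, (c, d) ∈ S → ¬ (a < c ∧ c < b ∧ b < d) ∧ ¬ (c < a ∧ a < d ∧ d < b)) :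
    IsEdge S a b := by
  by_cases h1 : b = a + 1
  · exact Or.inl h1
  · exact Or.inr (hS.2 _ (hS.1.insert_arc (by omega) hb h))

lemma IsMaxNonCrossing.isEdge_base (hS : IsMaxNonCrossing n S) (hn : 0 < n) : IsEdge S 0 n := by
  refine hS.isEdge hn le_rfl fun c d hcd => ?_
  have := (hS.1.1 _ hcd).2
  dsimp only at this
  omega

/-- Every arc of a maximal non-crossing set is the base of a triangle. -/
lemma IsMaxNonCrossing.exists_apex (hS : IsMaxNonCrossing n S) {a c : ℕ} (hac : (a, c) ∈ S) :
    ∃ b, a < b ∧ b < c ∧ IsEdge S a b ∧ IsEdge S b c := by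
  classical
  have hlen : a + 2 ≤ c ∧ c ≤ n := hS.1.1 _ hac
  have hex : ∃ b, b < c ∧ IsEdge S a b := ⟨a + 1, by omega, Or.inl rfl⟩
  set b := Nat.findGreatest (fun b => b < c ∧ IsEdge S a b) c with hb
  obtain ⟨hbc, hab⟩ : b < c ∧ IsEdge S a b := by
    obtain ⟨b', hb'⟩ := hex
    exact Nat.findGreatest_spec (P := fun b => b < c ∧ IsEdge S a b) hb'.1.le hb'
  have hmax : ∀ b', b < b' → b' < c → ¬ IsEdge S a b' := fun b' h1 h2 h3 =>
    Nat.findGreatest_is_greatest h1 h2.le ⟨h2, h3⟩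
  have hltab := hS.1.edge_lt hab
  refine ⟨b, hltab, hbc, hab, hS.isEdge hbc hlen.2 fun x y hxy => ?_⟩
  have h1 := hS.1.not_cross (Or.inr hac) hxy
  have h2 := hS.1.not_cross hab hxy
  refine ⟨by omega, fun h => ?_⟩
  obtain rfl : x = a := by omega
  exact hmax y h.2.1 h.2.2 (Or.inr hxy)

/-- Every arc of a maximal non-crossing set other than the base lies on a triangle whose third
vertex is outside the arc. -/
lemma IsMaxNonCrossing.exists_outer_apex (hS : IsMaxNonCrossing n S) {a c : ℕ} (hac : (a, c) ∈ S)
    (hne : (a, c) ≠ (0, n)) :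
    (∃ e, c < e ∧ IsEdge S c e ∧ (a, e) ∈ S) ∨ ∃ e, e < a ∧ IsEdge S e a ∧ (e, c) ∈ S := by
  classical
  have hlen : a + 2 ≤ c ∧ c ≤ n := hS.1.1 _ hac
  have hbase : (0, n) ∈ S := by
    rcases hS.isEdge_base (by omega) with h | h
    · omega
    · exact h
  obtain ⟨⟨x, y⟩, hxy, hmin⟩ := Finset.exists_min_image
    (S.filter fun p => p.1 ≤ a ∧ c ≤ p.2 ∧ p ≠ (a, c)) (fun p => p.2 - p.1)
    ⟨(0, n), by simpa [hbase, hlen.2] using hne.symm⟩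
  simp only [Finset.mem_filter] at hxy
  obtain ⟨hxyS, hxa, hcy, hxyne⟩ := hxy
  obtain ⟨b, hxb, hby, exb, eby⟩ := hS.exists_apex hxyS
  have h1 := hS.1.not_cross exb hac
  have h2 := hS.1.not_cross eby hac
  rcases le_or_gt c b with hcb | hbc
  · have hxbS : (x, b) ∈ S := exb.resolve_left (by omega)
    have : (x, b) = (a, c) := by
      by_contra hcon
      have := hmin (x, b) (by simp only [Finset.mem_filter]; exact ⟨hxbS, hxa, hcb, hcon⟩)
      dsimp only at this
      omega
    simp only [Prod.mk.injEq] at this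
    obtain ⟨rfl, rfl⟩ := this
    exact Or.inl ⟨y, hby, eby, hxyS⟩
  · have hba : b ≤ a := by
      by_contra hcon
      simp only [ne_eq, Prod.mk.injEq, not_and] at hxyne
      omega
    have hbyS : (b, y) ∈ S := eby.resolve_left (by omega)
    have : (b, y) = (a, c) := by
      by_contra hcon
      have := hmin (b, y) (by simp only [Finset.mem_filter]; exact ⟨hbyS, hba, hcy, hcon⟩)
      dsimp only at this
      omega
    simp only [Prod.mk.injEq] at this
    obtain ⟨rfl, rfl⟩ := this
    exact Or.inr ⟨x, hxb, exb, hxyS⟩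

lemma IsMaxNonCrossing.card_filter (hS : IsMaxNonCrossing n S) (l : ℕ) :
    ∀ a c, c = a + l + 1 → IsEdge S a c →
      (S.filter fun p => a ≤ p.1 ∧ p.2 ≤ c).card = l := by
  induction l using Nat.strong_induction_on with
  | _ l ih =>
    intro a c hc hac
    rcases Nat.eq_zero_or_pos l with rfl | hl
    · refine Finset.card_eq_zero.2 (Finset.filter_eq_empty_iff.2 fun p hp => ?_)
      have := (hS.1.1 p hp).1
      omega
    have hacS : (a, c) ∈ S := hac.resolve_left (by omega)
    obtain ⟨b, hab, hbc, eab, ebc⟩ := hS.exists_apex hacS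
    have h1 := ih (b - a - 1) (by omega) a b (by omega) eab
    have h2 := ih (c - b - 1) (by omega) b c (by omega) ebc
    have hsplit : (S.filter fun p => a ≤ p.1 ∧ p.2 ≤ c) = insert (a, c)
        ((S.filter fun p => a ≤ p.1 ∧ p.2 ≤ b) ∪ S.filter fun p => b ≤ p.1 ∧ p.2 ≤ c) := by
      ext ⟨x, y⟩
      simp only [Finset.mem_filter, Finset.mem_insert, Finset.mem_union, Prod.mk.injEq]
      constructor
      · rintro ⟨hxy, h3, h4⟩
        have h5 := hS.1.not_cross eab hxy
        have h6 := hS.1.not_cross ebc hxy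
        by_cases h7 : x = a ∧ y = c
        · exact Or.inl h7
        · by_cases h8 : y ≤ b
          · exact Or.inr (Or.inl ⟨hxy, h3, h8⟩)
          · exact Or.inr (Or.inr ⟨hxy, by omega, h4⟩)
      · rintro (⟨rfl, rfl⟩ | ⟨hxy, h3, h4⟩ | ⟨hxy, h3, h4⟩)
        · exact ⟨hacS, le_rfl, le_rfl⟩
        · exact ⟨hxy, h3, by omega⟩
        · exact ⟨hxy, by omega, h4⟩
    rw [hsplit, Finset.card_insert_of_notMem, Finset.card_union_of_disjoint, h1, h2]
    · omega
    · rw [Finset.disjoint_left]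
      rintro ⟨x, y⟩ hx hy
      simp only [Finset.mem_filter] at hx hy
      have := (hS.1.1 _ hx.1).1
      dsimp only at this
      omega
    · simp only [Finset.mem_union, Finset.mem_filter]
      omega

lemma IsMaxNonCrossing.card_eq (hS : IsMaxNonCrossing n S) (hn : 0 < n) : S.card = n - 1 := by
  rw [← hS.card_filter (n - 1) 0 n (by omega) (hS.isEdge_base hn), Finset.filter_true_of_mem]
  exact fun p hp => ⟨Nat.zero_le _, (hS.1.1 p hp).2⟩

lemma IsNonCrossing.isMax_of_card (hS : IsNonCrossing n S) (hn : 0 < n) (hc : S.card = n - 1) :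
    IsMaxNonCrossing n S := by
  obtain ⟨T, hST, hT⟩ := hS.exists_maximal
  rwa [Finset.eq_of_subset_of_card_le hST (by rw [hT.card_eq hn, hc])]

/-- Exchanging the two diagonals of a quadrilateral, from `(w, y)` to `(x, z)`. -/
lemma IsNonCrossing.flip_right (hS : IsNonCrossing n S) {w x y z : ℕ} (hwx : IsEdge S w x)
    (hxy : IsEdge S x y) (hyz : IsEdge S y z) (hwz : (w, z) ∈ S) (hwy : (w, y) ∉ S) :
    IsNonCrossing n (insert (x, z) S) := by
  have h1 := hS.edge_lt hxy
  have h2 := hS.edge_lt hyz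
  refine hS.insert_arc (by omega) (hS.1 _ hwz).2 fun u v huv => ?_
  have h3 := hS.not_cross hwx huv
  have h4 := hS.not_cross hxy huv
  have h5 := hS.not_cross hyz huv
  have h6 := hS.not_cross (Or.inr hwz) huv
  have h7 := hS.edge_lt hwx
  have h8 : ¬ (u = w ∧ v = y) := by rintro ⟨rfl, rfl⟩; exact hwy huv
  omega

/-- Exchanging the two diagonals of a quadrilateral, from `(x, z)` to `(w, y)`. -/
lemma IsNonCrossing.flip_left (hS : IsNonCrossing n S) {w x y z : ℕ} (hwx : IsEdge S w x)
    (hxy : IsEdge S x y) (hyz : IsEdge S y z) (hwz : (w, z) ∈ S) (hxz : (x, z) ∉ S) :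
    IsNonCrossing n (insert (w, y) S) := by
  have h1 := hS.edge_lt hxy
  have h2 := hS.edge_lt hyz
  have h7 := hS.edge_lt hwx
  refine hS.insert_arc (by omega) (h2.le.trans (hS.1 _ hwz).2) fun u v huv => ?_
  have h3 := hS.not_cross hwx huv
  have h4 := hS.not_cross hxy huv
  have h5 := hS.not_cross hyz huv
  have h6 := hS.not_cross (Or.inr hwz) huv
  have h8 : ¬ (u = x ∧ v = z) := by rintro ⟨rfl, rfl⟩; exact hxz huv
  omega

/-- An arc that crosses no side of a quadrilateral but crosses one of its diagonals is the other
diagonal. -/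
lemma IsNonCrossing.eq_of_cross {w x y z u v : ℕ} (hS : IsNonCrossing n S)
    (hT : IsNonCrossing n (insert (u, v) S)) (hwx : IsEdge S w x) (hxy : IsEdge S x y)
    (hyz : IsEdge S y z) (hwz : (w, z) ∈ S) :
    ((w < u ∧ u < y ∧ y < v) ∨ (u < w ∧ w < v ∧ v < y) → (u, v) = (x, z)) ∧
    ((x < u ∧ u < z ∧ z < v) ∨ (u < x ∧ x < v ∧ v < z) → (u, v) = (w, y)) := by
  have mono : ∀ {a b}, IsEdge S a b → IsEdge (insert (u, v) S) a b :=
    fun h => h.imp_right (Finset.mem_insert_of_mem)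
  have huv := Finset.mem_insert_self (u, v) S
  have h1 := hS.edge_lt hxy
  have h2 := hS.edge_lt hyz
  have h7 := hS.edge_lt hwx
  have h3 := hT.not_cross (mono hwx) huv
  have h4 := hT.not_cross (mono hxy) huv
  have h5 := hT.not_cross (mono hyz) huv
  have h6 := hT.not_cross (mono (Or.inr hwz)) huv
  simp only [Prod.mk.injEq]
  omega

lemma isEdge_erase {a b : ℕ} {p : ℕ × ℕ} (h : IsEdge S a b) (hne : (a, b) ≠ p) :
    IsEdge (S.erase p) a b :=
  h.imp_right fun h => Finset.mem_erase.2 ⟨hne, h⟩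

lemma card_insert_erase {p q : ℕ × ℕ} (hp : p ∈ S) (hq : q ∉ S) :
    (insert q (S.erase p)).card = S.card := by
  rw [Finset.card_insert_of_notMem fun h => hq (Finset.mem_of_mem_erase h),
    Finset.card_erase_add_one hp]

/-- An arc of a maximal non-crossing set other than the base can be replaced in exactly one way. -/
lemma IsMaxNonCrossing.exists_flip (hT : IsMaxNonCrossing n T) {d : ℕ × ℕ} (hd : d ∈ T)
    (hne : d ≠ (0, n)) :
    ∃ q, q ∉ T ∧ IsNonCrossing n (insert q (T.erase d)) ∧
      ∀ r, IsNonCrossing n (insert r (T.erase d)) → r ∈ T ∨ r = q := by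
  obtain ⟨a, c⟩ := d
  have hS : IsNonCrossing n (T.erase (a, c)) := hT.1.subset (Finset.erase_subset _ _)
  have hdS : (a, c) ∉ T.erase (a, c) := Finset.notMem_erase _ _
  have key : ∀ u v, IsNonCrossing n (insert (u, v) (T.erase (a, c))) →
      ¬ ((a < u ∧ u < c ∧ c < v) ∨ (u < a ∧ a < v ∧ v < c)) → (u, v) ∈ T := by
    intro u v huv hnc
    refine hT.2 _ (hT.1.insert_arc (huv.1 _ (Finset.mem_insert_self _ _)).1
      (huv.1 _ (Finset.mem_insert_self _ _)).2 fun x y hxy => ?_)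
    by_cases h : (x, y) = (a, c)
    · simp only [Prod.mk.injEq] at h
      omega
    · exact huv.not_cross (Or.inr (Finset.mem_insert_self _ _))
        (Finset.mem_insert_of_mem (Finset.mem_erase.2 ⟨h, hxy⟩))
  obtain ⟨b, hab, hbc, eab, ebc⟩ := hT.exists_apex hd
  rcases hT.exists_outer_apex hd hne with ⟨e, hce, ece, hae⟩ | ⟨e, hea, eea, hec⟩
  · have s1 := isEdge_erase (p := (a, c)) eab (by simp only [ne_eq, Prod.mk.injEq]; omega)
    have s2 := isEdge_erase (p := (a, c)) ebc (by simp only [ne_eq, Prod.mk.injEq]; omega)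
    have s3 := isEdge_erase (p := (a, c)) ece (by simp only [ne_eq, Prod.mk.injEq]; omega)
    have s4 : (a, e) ∈ T.erase (a, c) :=
      Finset.mem_erase.2 ⟨by simp only [ne_eq, Prod.mk.injEq]; omega, hae⟩
    refine ⟨(b, e), fun h => hT.1.2 _ hd _ h ⟨hab, hbc, hce⟩,
      hS.flip_right s1 s2 s3 s4 hdS, fun ⟨u, v⟩ huv => ?_⟩
    by_contra! hcon
    exact hcon.1 (key u v huv fun h => hcon.2 ((hS.eq_of_cross huv s1 s2 s3 s4).1 h))
  · have s1 := isEdge_erase (p := (a, c)) eea (by simp only [ne_eq, Prod.mk.injEq]; omega)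
    have s2 := isEdge_erase (p := (a, c)) eab (by simp only [ne_eq, Prod.mk.injEq]; omega)
    have s3 := isEdge_erase (p := (a, c)) ebc (by simp only [ne_eq, Prod.mk.injEq]; omega)
    have s4 : (e, c) ∈ T.erase (a, c) :=
      Finset.mem_erase.2 ⟨by simp only [ne_eq, Prod.mk.injEq]; omega, hec⟩
    refine ⟨(e, b), fun h => hT.1.2 _ h _ hd ⟨hea, hab, hbc⟩,
      hS.flip_left s1 s2 s3 s4 hdS, fun ⟨u, v⟩ huv => ?_⟩
    by_contra! hcon
    exact hcon.1 (key u v huv fun h => hcon.2 ((hS.eq_of_cross huv s1 s2 s3 s4).2 h))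

/-- A non-crossing set containing the base and missing one arc has exactly two completions. -/
lemma IsNonCrossing.exists_two_completions (hS : IsNonCrossing n S) (hn : 2 ≤ n)
    (hbase : (0, n) ∈ S) (hc : S.card = n - 2) :
    ∃ T₁ T₂, T₁ ≠ T₂ ∧ IsMaxNonCrossing n T₁ ∧ S ⊆ T₁ ∧ IsMaxNonCrossing n T₂ ∧ S ⊆ T₂ ∧
      ∀ T, IsMaxNonCrossing n T → S ⊆ T → T = T₁ ∨ T = T₂ := by
  obtain ⟨T, hST, hT⟩ := hS.exists_maximal
  have eq_insert : ∀ U, IsMaxNonCrossing n U → S ⊆ U → ∃ p ∉ S, U = insert p S := by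
    intro U hU hSU
    have hcU := hU.card_eq (by omega)
    obtain ⟨p, hp, h⟩ := (Finset.covBy_iff_exists_insert (s := S) (t := U)).1
      (Finset.covBy_iff_card_sdiff_eq_one.2 ⟨hSU, by rw [Finset.card_sdiff_of_subset hSU]; omega⟩)
    exact ⟨p, hp, h.symm⟩
  obtain ⟨d, hd, rfl⟩ := eq_insert T hT hST
  obtain ⟨q, hq, hq', hq''⟩ := hT.exists_flip (Finset.mem_insert_self d S)
    (by rintro rfl; exact hd hbase)
  rw [Finset.erase_insert hd] at hq' hq''
  have hqS : q ∉ S := fun h => hq (Finset.mem_insert_of_mem h)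
  refine ⟨insert d S, insert q S, fun h => hq (h ▸ Finset.mem_insert_self q S), hT, hST,
    hq'.isMax_of_card (by omega) ?_, Finset.subset_insert _ _, fun U hU hSU => ?_⟩
  · rw [Finset.card_insert_of_notMem hqS]
    omega
  · obtain ⟨r, hr, rfl⟩ := eq_insert U hU hSU
    rcases hq'' r hU.1 with h | rfl
    · rcases Finset.mem_insert.1 h with rfl | h
      exacts [Or.inl rfl, absurd h hr]
    · exact Or.inr rfl

/-- A flip between two maximal non-crossing sets of arcs. -/
def ArcFlip (n : ℕ) (T U : Finset (ℕ × ℕ)) : Prop :=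
  IsMaxNonCrossing n T ∧ IsMaxNonCrossing n U ∧ (T ∩ U).card = n - 2

/-- The set of all arcs starting at `0`. -/
def fan (n : ℕ) : Finset (ℕ × ℕ) := (Finset.Icc 2 n).image fun k => (0, k)

/-- A maximal non-crossing set other than the fan admits a flip creating an arc at `0`. -/
lemma IsMaxNonCrossing.exists_flip_toward_fan (hT : IsMaxNonCrossing n T) (hn : 0 < n)
    (hne : T ≠ fan n) :
    ∃ U, ArcFlip n T U ∧ (T.filter fun p => p.1 = 0) ⊂ U.filter fun p => p.1 = 0 := by
  classical
  have hcard := hT.card_eq hn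
  have hmiss : ∃ k, 0 < k ∧ k ≤ n ∧ ¬ IsEdge T 0 k := by
    by_contra! hcon
    refine hne (Finset.eq_of_subset_of_card_le ?_ ?_).symm
    · simp only [fan, Finset.subset_iff, Finset.mem_image, Finset.mem_Icc]
      rintro _ ⟨k, hk, rfl⟩
      exact (hcon k (by omega) hk.2).resolve_left (by omega)
    · rw [fan, Finset.card_image_of_injective _ fun a b h => (Prod.mk.inj h).2, Nat.card_Icc]
      omega
  obtain ⟨hk0, hkn, hk⟩ := Nat.find_spec hmiss
  have hkmin := fun j => Nat.find_min hmiss (m := j)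
  set k := Nat.find hmiss
  have hk1 : k ≠ 1 := fun h => hk (Or.inl h)
  have e0a : IsEdge T 0 (k - 1) := by
    by_contra hcon
    exact hkmin (k - 1) (by omega) ⟨by omega, by omega, hcon⟩
  have hnext : ∃ c, k < c ∧ IsEdge T 0 c :=
    ⟨n, lt_of_le_of_ne hkn fun h => hk (h ▸ hT.isEdge_base hn), hT.isEdge_base hn⟩
  obtain ⟨hkc, e0c⟩ := Nat.find_spec hnext
  have hcmin := fun j => Nat.find_min hnext (m := j)
  set c := Nat.find hnext
  have h0c : (0, c) ∈ T := e0c.resolve_left (by omega)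
  obtain ⟨b', h0b', hb'c, e0b', eb'c⟩ := hT.exists_apex h0c
  have hb'k : b' < k := by
    by_contra hcon
    rcases eq_or_lt_of_le (not_lt.1 hcon) with h | h
    · exact hk (h ▸ e0b')
    · exact hcmin b' hb'c ⟨h, e0b'⟩
  have hb'cT : (b', c) ∈ T := eb'c.resolve_left (by omega)
  obtain rfl : b' = k - 1 := by
    have := hT.1.not_cross e0a hb'cT
    omega
  obtain ⟨b, hab, hbc, eab, ebc⟩ := hT.exists_apex hb'cT
  have h0b : (0, b) ∉ T := fun h => hT.1.2 _ h _ hb'cT ⟨h0b', hab, hbc⟩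
  have hS : IsNonCrossing n (T.erase (k - 1, c)) := hT.1.subset (Finset.erase_subset _ _)
  have hU : IsNonCrossing n (insert (0, b) (T.erase (k - 1, c))) := by
    refine hS.flip_left (x := k - 1) (z := c) (isEdge_erase e0a ?_) (isEdge_erase eab ?_)
      (isEdge_erase ebc ?_) (Finset.mem_erase.2 ⟨?_, h0c⟩) (Finset.notMem_erase _ _) <;>
    · simp only [ne_eq, Prod.mk.injEq]
      omega
  refine ⟨_, ⟨hT, hU.isMax_of_card hn (by rw [card_insert_erase hb'cT h0b, hcard]), ?_⟩, ?_⟩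
  · rw [Finset.inter_insert_of_notMem h0b, Finset.inter_eq_right.2 (Finset.erase_subset _ _),
      Finset.card_erase_of_mem hb'cT]
    omega
  · refine Finset.ssubset_iff_subset_ne.2 ⟨?_, fun h => h0b ?_⟩
    · intro p hp
      obtain ⟨hp, h0⟩ := Finset.mem_filter.1 hp
      refine Finset.mem_filter.2 ⟨Finset.mem_insert_of_mem (Finset.mem_erase.2 ⟨?_, hp⟩), h0⟩
      rintro rfl
      dsimp only at h0
      omega
    · have : (0, b) ∈ T.filter fun p => p.1 = 0 := by
        rw [h]
        exact Finset.mem_filter.2 ⟨Finset.mem_insert_self _ _, rfl⟩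
      exact (Finset.mem_filter.1 this).1

instance : Std.Symm (ArcFlip n) :=
  ⟨fun _ _ h => ⟨h.2.1, h.1, by rw [Finset.inter_comm, h.2.2]⟩⟩

lemma IsMaxNonCrossing.reflTransGen_fan (hT : IsMaxNonCrossing n T) (hn : 0 < n) :
    Relation.ReflTransGen (ArcFlip n) T (fan n) := by
  induction h : n - (T.filter fun p => p.1 = 0).card using Nat.strong_induction_on generalizing T
    with
  | _ k ih =>
    by_cases hne : T = fan n
    · rw [hne]
    obtain ⟨U, hU, hlt⟩ := hT.exists_flip_toward_fan hn hne
    have h1 := Finset.card_lt_card hlt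
    have h2 := Finset.card_filter_le U fun p => p.1 = 0
    rw [hU.2.1.card_eq hn] at h2
    exact .head hU (ih _ (by omega) hU.2.1 rfl)

lemma IsMaxNonCrossing.reflTransGen (hS : IsMaxNonCrossing n S) (hT : IsMaxNonCrossing n T)
    (hn : 0 < n) : Relation.ReflTransGen (ArcFlip n) S T :=
  (hS.reflTransGen_fan hn).trans
    (Relation.ReflTransGen.stdSymm.symm _ _ (hT.reflTransGen_fan hn))

end Arcs

/-! ### Chords of the polygon as arcs -/

section Transfer

variable {m : ℕ}

/-- The chord of `P_m` joining two numbered vertices. -/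
def chord (m : ℕ) (p : ℕ × ℕ) : Sym2 (ZMod m) := s((p.1 : ZMod m), (p.2 : ZMod m))

/-- The endpoints of a chord, numbered from `0` to `m - 1`, in increasing order. -/
def ends (e : Sym2 (ZMod m)) : ℕ × ℕ := ((e.map ZMod.val).inf, (e.map ZMod.val).sup)

lemma ends_mk (a b : ZMod m) : ends s(a, b) = (min a.val b.val, max a.val b.val) := rfl

lemma chord_ends [NeZero m] (e : Sym2 (ZMod m)) : chord m (ends e) = e := by
  induction e using Sym2.ind with
  | _ a b =>
    rw [ends_mk, chord]
    rcases le_total a.val b.val with h | h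
    · simp [h]
    · simp [h, Sym2.eq_swap]

lemma ends_chord {p : ℕ × ℕ} (h : p.1 < p.2) (h' : p.2 < m) : ends (chord m p) = p := by
  rw [chord, ends_mk, ZMod.val_cast_of_lt (h.trans h'), ZMod.val_cast_of_lt h', min_eq_left h.le,
    max_eq_right h.le]

lemma ends_injective [NeZero m] : Function.Injective (ends (m := m)) :=
  Function.LeftInverse.injective chord_ends

lemma val_sub_eq [NeZero m] (a b : ZMod m) :
    (b - a).val = if a.val ≤ b.val then b.val - a.val else b.val + m - a.val := by
  split_ifs with h
  · exact ZMod.val_sub h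
  · have h1 := ZMod.val_sub (not_le.1 h).le
    have h2 := ZMod.neg_val (a - b)
    have h3 := ZMod.val_lt a
    rw [neg_sub, h1, if_neg] at h2
    · omega
    · rw [sub_eq_zero]
      rintro rfl
      exact h le_rfl

lemma isDiag_mk_iff [NeZero m] (hm : 4 ≤ m) (a b : ZMod m) :
    (b - a ≠ 0 ∧ b - a ≠ 1 ∧ b - a ≠ -1) ↔
      IsArc (m - 1) (ends s(a, b)) ∧ ends s(a, b) ≠ (0, m - 1) := by
  have : Fact (1 < m) := ⟨by omega⟩
  have h1 : (-1 : ZMod m).val = m - 1 := by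
    rw [ZMod.neg_val, if_neg one_ne_zero, ZMod.val_one]
  have ha := ZMod.val_lt a
  have hb := ZMod.val_lt b
  simp only [ne_eq, ← (ZMod.val_injective m).eq_iff, h1, ZMod.val_zero, ZMod.val_one, val_sub_eq,
    ends_mk, IsArc, Prod.mk.injEq]
  split_ifs <;> omega

lemma isDiag_iff [NeZero m] (hm : 4 ≤ m) (e : Sym2 (ZMod m)) :
    IsDiag m e ↔ IsArc (m - 1) (ends e) ∧ ends e ≠ (0, m - 1) := by
  constructor
  · rintro ⟨a, b, rfl, h⟩
    exact (isDiag_mk_iff hm a b).1 h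
  · induction e using Sym2.ind with
    | _ a b => exact fun h => ⟨a, b, rfl, (isDiag_mk_iff hm a b).2 h⟩

lemma cross_mk_iff [NeZero m] (a b c d : ZMod m) (hab : a ≠ b) (hcd : c ≠ d) :
    (a ≠ b ∧ a ≠ c ∧ a ≠ d ∧ b ≠ c ∧ b ≠ d ∧ c ≠ d ∧
      Xor' (StrictBtw m a c b) (StrictBtw m a d b)) ↔
      Overlap (ends s(a, b)) (ends s(c, d)) ∨ Overlap (ends s(c, d)) (ends s(a, b)) := by
  have ha := ZMod.val_lt a
  have hb := ZMod.val_lt b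
  have hc := ZMod.val_lt c
  have hd := ZMod.val_lt d
  simp only [ne_eq, ← (ZMod.val_injective m).eq_iff, StrictBtw, val_sub_eq, ends_mk, Overlap,
    Xor', Xor] at *
  generalize a.val = a at *
  generalize b.val = b at *
  generalize c.val = c at *
  generalize d.val = d at *
  split_ifs <;> omega

lemma cross_iff [NeZero m] {e f : Sym2 (ZMod m)} (he : (ends e).1 < (ends e).2)
    (hf : (ends f).1 < (ends f).2) :
    Cross m e f ↔ Overlap (ends e) (ends f) ∨ Overlap (ends f) (ends e) := by
  constructor
  · rintro ⟨a, b, c, d, rfl, rfl, h⟩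
    exact (cross_mk_iff a b c d h.1 h.2.2.2.2.2.1).1 h
  · induction e using Sym2.ind with
    | _ a b =>
      induction f using Sym2.ind with
      | _ c d =>
        refine fun h => ⟨a, b, c, d, rfl, rfl, (cross_mk_iff a b c d ?_ ?_).2 h⟩
        · rintro rfl
          simp [ends_mk] at he
        · rintro rfl
          simp [ends_mk] at hf

/-- The arcs of a set of chords, together with the base `(0, m - 1)`. -/
def toArcs (S : Finset (Sym2 (ZMod m))) : Finset (ℕ × ℕ) := insert (0, m - 1) (S.image ends)

/-- The chords of a set of arcs other than the base `(0, m - 1)`. -/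
def toChords (m : ℕ) (U : Finset (ℕ × ℕ)) : Finset (Sym2 (ZMod m)) :=
  (U.erase (0, m - 1)).image (chord m)

lemma toArcs_mono {S T : Finset (Sym2 (ZMod m))} (h : S ⊆ T) : toArcs S ⊆ toArcs T :=
  Finset.insert_subset_insert _ (Finset.image_subset_image h)

lemma toChords_mono {U V : Finset (ℕ × ℕ)} (h : U ⊆ V) : toChords m U ⊆ toChords m V :=
  Finset.image_subset_image (Finset.erase_subset_erase _ h)

lemma base_notMem_image_ends [NeZero m] (hm : 4 ≤ m) {S : Finset (Sym2 (ZMod m))}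
    (hS : ∀ e ∈ S, IsDiag m e) : (0, m - 1) ∉ S.image ends := by
  simp only [Finset.mem_image, not_exists, not_and]
  exact fun e he => ((isDiag_iff hm e).1 (hS e he)).2

lemma card_toArcs [NeZero m] (hm : 4 ≤ m) {S : Finset (Sym2 (ZMod m))}
    (hS : ∀ e ∈ S, IsDiag m e) : (toArcs S).card = S.card + 1 := by
  rw [toArcs, Finset.card_insert_of_notMem (base_notMem_image_ends hm hS),
    Finset.card_image_of_injective _ ends_injective]

lemma toChords_toArcs [NeZero m] (hm : 4 ≤ m) {S : Finset (Sym2 (ZMod m))}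
    (hS : ∀ e ∈ S, IsDiag m e) : toChords m (toArcs S) = S := by
  rw [toChords, toArcs, Finset.erase_insert (base_notMem_image_ends hm hS), Finset.image_image]
  rw [show chord m ∘ ends = id from funext chord_ends, Finset.image_id]

lemma isNonCrossing_toArcs [NeZero m] (hm : 4 ≤ m) {S : Finset (Sym2 (ZMod m))}
    (hS : ∀ e ∈ S, IsDiag m e) (hS' : ∀ e ∈ S, ∀ f ∈ S, e ≠ f → ¬ Cross m e f) :
    IsNonCrossing (m - 1) (toArcs S) := by
  have harc : ∀ e ∈ S, IsArc (m - 1) (ends e) := fun e he => ((isDiag_iff hm e).1 (hS e he)).1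
  have hlt : ∀ e ∈ S, (ends e).1 < (ends e).2 := fun e he => by
    have := (harc e he).1
    omega
  refine IsNonCrossing.insert_arc ⟨?_, ?_⟩ (by omega) le_rfl ?_
  · simpa only [Finset.forall_mem_image] using harc
  · simp only [Finset.forall_mem_image]
    intro e he f hf h
    refine hS' e he f hf ?_ ((cross_iff (hlt e he) (hlt f hf)).2 (Or.inl h))
    rintro rfl
    exact lt_irrefl _ h.1
  · simp only [Finset.mem_image]
    rintro c d ⟨e, he, hcd⟩
    have := (harc e he).2
    rw [hcd] at this
    dsimp only at this
    omega

lemma IsArc.ends_chord (hm : 0 < m) {p : ℕ × ℕ} (hp : IsArc (m - 1) p) :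
    ends (chord m p) = p := by
  have h1 := hp.1
  have h2 := hp.2
  exact Poly.ends_chord (by omega) (by omega)

lemma toArcs_toChords (hm : 0 < m) {U : Finset (ℕ × ℕ)} (hU : IsNonCrossing (m - 1) U)
    (hbase : (0, m - 1) ∈ U) : toArcs (toChords m U) = U := by
  rw [toArcs, toChords, Finset.image_image]
  have : (U.erase (0, m - 1)).image (ends ∘ chord m) = (U.erase (0, m - 1)).image id :=
    Finset.image_congr fun p hp => (hU.1 p (Finset.mem_of_mem_erase hp)).ends_chord hm
  rw [this, Finset.image_id, Finset.insert_erase hbase]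

lemma isDiag_of_mem_toChords [NeZero m] (hm : 4 ≤ m) {U : Finset (ℕ × ℕ)}
    (hU : IsNonCrossing (m - 1) U) : ∀ e ∈ toChords m U, IsDiag m e := by
  simp only [toChords, Finset.forall_mem_image]
  intro p hp
  have harc := hU.1 p (Finset.mem_of_mem_erase hp)
  rw [isDiag_iff hm, harc.ends_chord (by omega)]
  exact ⟨harc, Finset.ne_of_mem_erase hp⟩

lemma IsMaxNonCrossing.base_mem {n : ℕ} {U : Finset (ℕ × ℕ)} (hU : IsMaxNonCrossing n U)
    (hn : 2 ≤ n) : (0, n) ∈ U :=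
  (hU.isEdge_base (by omega)).resolve_left (by omega)

lemma isTriangulation_toChords [NeZero m] (hm : 4 ≤ m) {U : Finset (ℕ × ℕ)}
    (hU : IsMaxNonCrossing (m - 1) U) : IsTriangulation m (toChords m U) := by
  have hdiag := isDiag_of_mem_toChords hm hU.1
  refine ⟨?_, hdiag, ?_⟩
  · have h1 := card_toArcs hm hdiag
    rw [toArcs_toChords (by omega) hU.1 (hU.base_mem (by omega)), hU.card_eq (by omega)] at h1
    omega
  · simp only [toChords, Finset.forall_mem_image]
    intro p hp q hq _
    have hp' := Finset.mem_of_mem_erase hp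
    have hq' := Finset.mem_of_mem_erase hq
    have harc := hU.1.1 p hp'
    have harc' := hU.1.1 q hq'
    have h1 := harc.1
    have h2 := harc'.1
    rw [cross_iff, harc.ends_chord (by omega), harc'.ends_chord (by omega)]
    · exact not_or.2 ⟨hU.1.2 p hp' q hq', hU.1.2 q hq' p hp'⟩
    · rw [harc.ends_chord (by omega)]
      omega
    · rw [harc'.ends_chord (by omega)]
      omega

lemma IsTriangulation.isMaxNonCrossing [NeZero m] (hm : 4 ≤ m) {T : Finset (Sym2 (ZMod m))}
    (hT : IsTriangulation m T) : IsMaxNonCrossing (m - 1) (toArcs T) := by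
  refine (isNonCrossing_toArcs hm hT.2.1 hT.2.2).isMax_of_card (by omega) ?_
  rw [card_toArcs hm hT.2.1, hT.1]
  omega

lemma ArcFlip.card_inter_toChords [NeZero m] (hm : 4 ≤ m) {U V : Finset (ℕ × ℕ)}
    (h : ArcFlip (m - 1) U V) : (toChords m U ∩ toChords m V).card = m - 4 := by
  have hU := toArcs_toChords (by omega) h.1.1 (h.1.base_mem (by omega))
  have hV := toArcs_toChords (by omega) h.2.1.1 (h.2.1.base_mem (by omega))
  have hinter : toArcs (toChords m U ∩ toChords m V) = U ∩ V := by
    rw [toArcs, Finset.image_inter _ _ ends_injective, Finset.insert_inter_distrib]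
    exact congrArg₂ _ hU hV
  have h1 := card_toArcs hm fun e he =>
    isDiag_of_mem_toChords hm h.1.1 e (Finset.mem_of_mem_inter_left (s₂ := toChords m V) he)
  rw [hinter, h.2.2] at h1
  omega

lemma FlipJoined.refl {T : Finset (Sym2 (ZMod m))} (hT : IsTriangulation m T) :
    FlipJoined m T T :=
  ⟨0, fun _ => T, rfl, rfl, fun _ => hT, fun i => i.elim0⟩

lemma FlipJoined.head {T₁ T₂ T₃ : Finset (Sym2 (ZMod m))} (hT : IsTriangulation m T₁)
    (h : (T₁ ∩ T₂).card = m - 4) (h' : FlipJoined m T₂ T₃) : FlipJoined m T₁ T₃ := by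
  obtain ⟨n, f, rfl, rfl, hf, hf'⟩ := h'
  refine ⟨n + 1, Fin.cons T₁ f, rfl, ?_, Fin.cases hT hf, Fin.cases h fun i => ?_⟩
  · rw [← Fin.succ_last, Fin.cons_succ]
  · rw [← Fin.succ_castSucc, Fin.cons_succ, Fin.cons_succ]
    exact hf' i

lemma flipJoined_of_reflTransGen [NeZero m] (hm : 4 ≤ m) {U V : Finset (ℕ × ℕ)}
    (hV : IsMaxNonCrossing (m - 1) V) (h : Relation.ReflTransGen (ArcFlip (m - 1)) U V) :
    FlipJoined m (toChords m U) (toChords m V) := by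
  induction h using Relation.ReflTransGen.head_induction_on with
  | refl => exact .refl (isTriangulation_toChords hm hV)
  | head h _ ih => exact ih.head (isTriangulation_toChords hm h.1) (h.card_inter_toChords hm)

end Transfer

/-- For `P_m` (`m ≥ 4`): every set of `m - 4` pairwise non-crossing
diagonals is contained in exactly two triangulations, and any two triangulations are
joined by a finite sequence of triangulations in which consecutive triangulations share
exactly `m - 4` diagonals. -/
theorem arc_complex_pseudomanifold (m : ℕ) (hm : 4 ≤ m) :
    (∀ S : Finset (Sym2 (ZMod m)), S.card = m - 4 →
        (∀ e ∈ S, IsDiag m e) →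
        (∀ e ∈ S, ∀ f ∈ S, e ≠ f → ¬ Cross m e f) →
        ∃ T₁ T₂ : Finset (Sym2 (ZMod m)), T₁ ≠ T₂ ∧
          IsTriangulation m T₁ ∧ S ⊆ T₁ ∧ IsTriangulation m T₂ ∧ S ⊆ T₂ ∧
          ∀ T, IsTriangulation m T → S ⊆ T → T = T₁ ∨ T = T₂) ∧
    (∀ T₁ T₂ : Finset (Sym2 (ZMod m)),
        IsTriangulation m T₁ → IsTriangulation m T₂ → FlipJoined m T₁ T₂) := by
  have : NeZero m := ⟨by omega⟩
  constructor
  · intro S hc hS hS'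
    obtain ⟨U, V, hne, hU, hSU, hV, hSV, huniq⟩ :=
      (isNonCrossing_toArcs hm hS hS').exists_two_completions (by omega)
        (Finset.mem_insert_self _ _) (by rw [card_toArcs hm hS]; omega)
    have hUeq := toArcs_toChords (by omega) hU.1 (hU.base_mem (by omega))
    have hVeq := toArcs_toChords (by omega) hV.1 (hV.base_mem (by omega))
    refine ⟨toChords m U, toChords m V, fun h => hne ?_, isTriangulation_toChords hm hU, ?_,
      isTriangulation_toChords hm hV, ?_, fun T hT hST => ?_⟩
    · rw [← hUeq, ← hVeq, h]
    · simpa only [toChords_toArcs hm hS] using toChords_mono (m := m) hSU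
    · simpa only [toChords_toArcs hm hS] using toChords_mono (m := m) hSV
    · rw [← toChords_toArcs hm hT.2.1]
      exact (huniq _ (hT.isMaxNonCrossing hm) (toArcs_mono hST)).imp (congrArg _) (congrArg _)
  · intro T₁ T₂ hT₁ hT₂
    have h₂ := hT₂.isMaxNonCrossing hm
    have h := flipJoined_of_reflTransGen hm h₂
      ((hT₁.isMaxNonCrossing hm).reflTransGen h₂ (by omega))
    rwa [toChords_toArcs hm hT₁.2.1, toChords_toArcs hm hT₂.2.1] at h

end Poly
end

section
/- For the convex m-gon P_m (m ≥ 4), there is an enumeration T_1, …, T_N of all triangulations of P_m such that for all indices 1 ≤ j < k ≤ N there exists i < k with |T_i ∩ T_k| = m−4 and T_j ∩ T_k ⊆ T_i ∩ T_k. (The arc complex of a convex polygon is shellable.) -/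
/-!
Vertices of the convex `m`-gon `P_m` are identified with `ZMod m` in cyclic order.
Blue is encoded by the Boolean value `true`, red by `false`.
-/

namespace Poly

/-- Chords of the polygon with vertices `0, …, m - 1`, written with increasing endpoints. -/
def IsChord (m : ℕ) (p : ℕ × ℕ) : Prop :=
  p.1 + 2 ≤ p.2 ∧ p.2 < m ∧ ¬ (p.1 = 0 ∧ p.2 + 1 = m)

/-- No two pairs of `S` interlace. -/
def Noncrossing (S : Finset (ℕ × ℕ)) : Prop :=
  ∀ i j k l, (i, j) ∈ S → (k, l) ∈ S → i < k → k < j → l ≤ j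

/-- Triangulations of the polygon with vertices `0, …, m - 1`, as sets of increasing pairs. -/
structure NatTriangulation (m : ℕ) (S : Finset (ℕ × ℕ)) : Prop where
  card : S.card = m - 3
  chord : ∀ p ∈ S, IsChord m p
  noncrossing : Noncrossing S

/-- `{i, j}`, with `i < j`, is a chord of `S` or a boundary edge of the polygon. -/
def IsSide (m : ℕ) (S : Finset (ℕ × ℕ)) (i j : ℕ) : Prop :=
  (i, j) ∈ S ∨ j = i + 1 ∨ (i = 0 ∧ j + 1 = m)

/-- The sum of the smaller endpoints; the shelling lists triangulations by increasing weight. -/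
def weight (S : Finset (ℕ × ℕ)) : ℕ := ∑ p ∈ S, p.1

lemma exists_last_neighbor (S : Finset (ℕ × ℕ)) {x y : ℕ} (h : x + 2 ≤ y) :
    ∃ z, x < z ∧ z < y ∧ ((x, z) ∈ S ∨ z = x + 1) ∧ ∀ j, z < j → j < y → (x, j) ∉ S := by
  classical
  let P : ℕ → Prop := fun j => x < j ∧ j < y ∧ ((x, j) ∈ S ∨ j = x + 1)
  have hP : P (x + 1) := ⟨by omega, by omega, Or.inr rfl⟩
  have hz : P (Nat.findGreatest P y) := Nat.findGreatest_spec (by omega) hP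
  refine ⟨_, hz.1, hz.2.1, hz.2.2, fun j hj hjy hmem => ?_⟩
  exact Nat.findGreatest_is_greatest hj hjy.le ⟨hz.1.trans hj, hjy, Or.inl hmem⟩

lemma Noncrossing.card_le {m : ℕ} {S : Finset (ℕ × ℕ)} (hS : Noncrossing S)
    (h : ∀ p ∈ S, p.1 + 2 ≤ p.2 ∧ p.2 < m) : S.card ≤ m - 2 := by
  classical
  have key : ∀ p : ℕ × ℕ, ∃ z, p ∈ S → p.1 < z ∧ z < p.2 ∧ ((p.1, z) ∈ S ∨ z = p.1 + 1) ∧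
      ∀ j, z < j → j < p.2 → (p.1, j) ∉ S := by
    intro p
    by_cases hp : p ∈ S
    · obtain ⟨z, hz⟩ := exists_last_neighbor S (h p hp).1
      exact ⟨z, fun _ => hz⟩
    · exact ⟨0, fun h => absurd h hp⟩
  choose g hg using key
  have hmaps : Set.MapsTo g S (Finset.Ico 1 (m - 1)) := by
    intro p hp
    have := hg p hp
    have := h p hp
    simp only [Finset.coe_Ico, Set.mem_Ico]
    omega
  have hlt : ∀ p ∈ S, ∀ q ∈ S, p.1 < q.1 → g p ≠ g q := by
    rintro ⟨a, b⟩ hp ⟨c, d⟩ hq hac heq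
    obtain ⟨h1, h2, h3, -⟩ := hg _ hp
    obtain ⟨h5, h6, -, -⟩ := hg _ hq
    dsimp only at *
    rcases h3 with h3 | h3
    · have := hS _ _ _ _ h3 hq hac (by omega)
      omega
    · omega
  have hle : ∀ p ∈ S, ∀ q ∈ S, p.1 = q.1 → p.2 < q.2 → g p ≠ g q := by
    rintro ⟨a, b⟩ hp ⟨c, d⟩ hq hac hbd heq
    dsimp only at hac hbd
    subst hac
    exact (hg _ hq).2.2.2 b (heq ▸ (hg _ hp).2.1) hbd hp
  have hinj : Set.InjOn g S := by
    intro p hp q hq heq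
    rcases lt_trichotomy p.1 q.1 with h1 | h1 | h1
    · exact absurd heq (hlt p hp q hq h1)
    · rcases lt_trichotomy p.2 q.2 with h2 | h2 | h2
      · exact absurd heq (hle p hp q hq h1 h2)
      · exact Prod.ext h1 h2
      · exact absurd heq.symm (hle q hq p hp h1.symm h2)
    · exact absurd heq.symm (hlt q hq p hp h1)
  have := Finset.card_le_card_of_injOn g hmaps hinj
  simp only [Nat.card_Ico] at this
  omega

namespace NatTriangulation

variable {m : ℕ} {S S' A : Finset (ℕ × ℕ)}

lemma maximal (hm : 4 ≤ m) (hS : NatTriangulation m S) {x y : ℕ} (hc : IsChord m (x, y))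
    (h1 : ∀ i j, (i, j) ∈ S → i < x → x < j → y ≤ j)
    (h2 : ∀ i j, (i, j) ∈ S → x < i → i < y → j ≤ y) : (x, y) ∈ S := by
  classical
  by_contra hn
  have hroot : (0, m - 1) ∉ insert (x, y) S := by
    intro h
    rcases Finset.mem_insert.1 h with h | h
    · rw [← h] at hc
      exact hc.2.2 ⟨rfl, by dsimp only; omega⟩
    · exact (hS.chord _ h).2.2 ⟨rfl, by dsimp only; omega⟩
  have hcard : (insert (0, m - 1) (insert (x, y) S)).card = S.card + 2 := by
    rw [Finset.card_insert_of_notMem hroot, Finset.card_insert_of_notMem hn]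
  have hle : (insert (0, m - 1) (insert (x, y) S)).card ≤ m - 2 := by
    have hch := hS.chord
    have hnc := hS.noncrossing
    simp only [IsChord, Noncrossing] at hch hnc hc
    apply Noncrossing.card_le
    · intro i j k l hi hk hik hkj
      simp only [Finset.mem_insert, Prod.mk.injEq] at hi hk
      rcases hi with hi | hi | hi <;> rcases hk with hk | hk | hk
      · omega
      · omega
      · have := hch _ hk
        dsimp only at this
        omega
      · omega
      · omega
      · obtain ⟨rfl, rfl⟩ := hi
        exact h2 _ _ hk hik hkj
      · omega
      · obtain ⟨rfl, rfl⟩ := hk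
        exact h1 _ _ hi hik hkj
      · exact hnc _ _ _ _ hi hk hik hkj
    · intro p hp
      simp only [Finset.mem_insert] at hp
      rcases hp with rfl | rfl | hp
      · dsimp only
        omega
      · exact ⟨hc.1, hc.2.1⟩
      · exact ⟨(hch p hp).1, (hch p hp).2.1⟩
  have := hS.card
  omega

lemma bounds (hS : NatTriangulation m S) {i j : ℕ} (h : (i, j) ∈ S) :
    i + 2 ≤ j ∧ j < m ∧ ¬ (i = 0 ∧ j + 1 = m) := hS.chord _ h

lemma side_right (hS : NatTriangulation m S) {i j k l : ℕ} (h : IsSide m S i j)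
    (hk : (k, l) ∈ S) (hik : i < k) (hkj : k < j) : l ≤ j := by
  have := hS.bounds hk
  rcases h with h | h | h
  · exact hS.noncrossing _ _ _ _ h hk hik hkj
  · omega
  · omega

lemma side_left (hS : NatTriangulation m S) {i j k l : ℕ} (h : IsSide m S i j)
    (hk : (k, l) ∈ S) (hki : k < i) (hil : i < l) : j ≤ l := by
  rcases h with h | h | h
  · exact hS.noncrossing _ _ _ _ hk h hki hil
  · omega
  · omega

lemma exists_inner_apex (hm : 4 ≤ m) (hS : NatTriangulation m S) {x y : ℕ} (hxy : x + 2 ≤ y)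
    (hym : y < m) (h : IsSide m S x y) :
    ∃ z, x < z ∧ z < y ∧ IsSide m S x z ∧ IsSide m S z y := by
  obtain ⟨z, hxz, hzy, hz, hlast⟩ := exists_last_neighbor S hxy
  have hxz' : IsSide m S x z := by
    rcases hz with hz | hz
    · exact Or.inl hz
    · exact Or.inr (Or.inl hz)
  refine ⟨z, hxz, hzy, hxz', ?_⟩
  by_cases hzy1 : y = z + 1
  · exact Or.inr (Or.inl hzy1)
  · refine Or.inl (hS.maximal hm ⟨by dsimp only; omega, hym, by dsimp only; omega⟩ ?_ ?_)
    · intro p q hpq hpz hzq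
      by_contra hqy
      rcases lt_trichotomy p x with hpx | rfl | hpx
      · have := hS.side_left h hpq hpx (by omega)
        omega
      · exact hlast q hzq (by omega) hpq
      · have := hS.side_right hxz' hpq hpx hpz
        omega
    · intro p q hpq hzp hpy
      exact hS.side_right h hpq (by omega) hpy

lemma exists_outer_apex (hm : 4 ≤ m) (hS : NatTriangulation m S) {x y : ℕ} (h : (x, y) ∈ S) :
    (∃ w, w < x ∧ IsSide m S w x ∧ IsSide m S w y) ∨
      ∃ w, y < w ∧ w < m ∧ IsSide m S x w := by
  classical
  let P : ℕ → Prop := fun n => ∃ u v, u ≤ x ∧ y ≤ v ∧ v < m ∧ ¬ (u = x ∧ v = y) ∧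
    v = u + n ∧ IsSide m S u v
  have hb := hS.bounds h
  have hP : ∃ n, P n :=
    ⟨m - 1, 0, m - 1, by omega, by omega, by omega, by omega, by omega, Or.inr (Or.inr (by omega))⟩
  obtain ⟨u, v, hux, hyv, hvm, hne, hlen, hside⟩ := Nat.find_spec hP
  have hmin : ∀ u' v', u' ≤ x → y ≤ v' → v' < m → v' - u' < v - u → IsSide m S u' v' →
      u' = x ∧ v' = y := by
    intro u' v' h1 h2 h3 h4 h5
    by_contra h6
    exact Nat.find_min hP (m := v' - u') (by omega) ⟨u', v', h1, h2, h3, h6, by omega, h5⟩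
  obtain ⟨z, huz, hzv, hs1, hs2⟩ := hS.exists_inner_apex hm (by omega) hvm hside
  by_cases hzx : z ≤ x
  · obtain ⟨rfl, rfl⟩ := hmin z v hzx hyv hvm (by omega) hs2
    exact Or.inl ⟨u, huz, hs1, hside⟩
  · by_cases hyz : y ≤ z
    · obtain ⟨rfl, rfl⟩ := hmin u z hux hyz (by omega) (by omega) hs1
      exact Or.inr ⟨v, hzv, hvm, hside⟩
    · exfalso
      rcases hux.lt_or_eq with hux | rfl
      · have := hS.side_right hs1 h hux (by omega)
        omega
      · have := hS.side_left hs2 h (by omega) (by omega)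
        omega

/-- The flip of `{x, y}` in the quadrilateral `w < x < z < y`. -/
lemma flip (hS : NatTriangulation m S) {w x y z : ℕ} (h : (x, y) ∈ S) (hwx : w < x)
    (hxz : x < z) (hzy : z < y) (h1 : IsSide m S w x) (h2 : IsSide m S w y)
    (h3 : IsSide m S x z) (h4 : IsSide m S z y) :
    NatTriangulation m (insert (w, z) (S.erase (x, y))) ∧
      (insert (w, z) (S.erase (x, y)) ∩ S).card = m - 4 ∧
      weight (insert (w, z) (S.erase (x, y))) < weight S := by
  have hb := hS.bounds h
  have hwz : (w, z) ∉ S := fun hmem => by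
    have := hS.noncrossing _ _ _ _ hmem h hwx hxz
    omega
  have hwz' : (w, z) ∉ S.erase (x, y) := fun hmem => hwz (Finset.mem_of_mem_erase hmem)
  have hcard := hS.card
  have hpos : 0 < S.card := Finset.card_pos.2 ⟨_, h⟩
  refine ⟨⟨?_, ?_, ?_⟩, ?_, ?_⟩
  · rw [Finset.card_insert_of_notMem hwz', Finset.card_erase_of_mem h]
    omega
  · intro p hp
    rcases Finset.mem_insert.1 hp with rfl | hp
    · refine ⟨?_, ?_, ?_⟩ <;> dsimp only <;> omega
    · exact hS.chord p (Finset.mem_of_mem_erase hp)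
  · intro i j k l hi hk hik hkj
    simp only [Finset.mem_insert, Finset.mem_erase, Prod.mk.injEq, ne_eq] at hi hk
    rcases hi with ⟨rfl, rfl⟩ | ⟨hne, hi⟩ <;> rcases hk with ⟨rfl, rfl⟩ | ⟨hne', hk⟩
    · omega
    · by_contra hlt
      have a1 := hS.side_right h2 hk hik (by omega)
      have a2 : i < k → k < x → l ≤ x := hS.side_right h1 hk
      have a3 : x < k → k < j → l ≤ j := hS.side_right h3 hk
      have a4 : k < j → j < l → y ≤ l := hS.side_left h4 hk
      omega
    · by_contra hlt
      have := hS.side_left h2 hi hik hkj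
      omega
    · exact hS.noncrossing _ _ _ _ hi hk hik hkj
  · rw [Finset.insert_inter_of_notMem hwz, Finset.inter_eq_left.2 (Finset.erase_subset _ _),
      Finset.card_erase_of_mem h]
    omega
  · unfold weight
    rw [Finset.sum_insert hwz', ← Finset.add_sum_erase S Prod.fst h]
    dsimp only
    omega

/-- No flip of `S` that keeps the chords of `A` decreases the weight. -/
def IsLocalMin (m : ℕ) (A S : Finset (ℕ × ℕ)) : Prop :=
  ∀ T, NatTriangulation m T → A ⊆ T → (T ∩ S).card = m - 4 → weight S ≤ weight T

lemma exists_next (hm : 4 ≤ m) (hS : NatTriangulation m S) (hA : A ⊆ S) (hmin : IsLocalMin m A S)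
    {x y : ℕ} (h : (x, y) ∈ S) (hxy : (x, y) ∉ A) : ∃ w, y < w ∧ w < m ∧ IsSide m S x w := by
  refine (hS.exists_outer_apex hm h).resolve_left ?_
  rintro ⟨w, hwx, h1, h2⟩
  have hb := hS.bounds h
  obtain ⟨z, hxz, hzy, h3, h4⟩ := hS.exists_inner_apex hm hb.1 hb.2.1 (Or.inl h)
  obtain ⟨hT, hcard, hlt⟩ := hS.flip h hwx hxz hzy h1 h2 h3 h4
  refine (hmin _ hT (fun p hp => ?_) hcard).not_gt hlt
  exact Finset.mem_insert_of_mem (Finset.mem_erase.2 ⟨fun e => hxy (e ▸ hp), hA hp⟩)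

lemma exists_fan_end (hm : 4 ≤ m) (hS : NatTriangulation m S) (hA : A ⊆ S)
    (hmin : IsLocalMin m A S) {x y : ℕ} (h : (x, y) ∈ S) (hxy : (x, y) ∉ A) :
    ∃ w, y < w ∧ ((x, w) ∈ A ∨ (x = 0 ∧ w + 1 = m)) := by
  induction hn : m - y using Nat.strong_induction_on generalizing y with
  | _ n ih =>
    obtain ⟨w, hyw, hwm, hside⟩ := hS.exists_next hm hA hmin h hxy
    have hb := hS.bounds h
    rcases hside with hw | hw | hw
    · by_cases hwA : (x, w) ∈ A
      · exact ⟨w, hyw, Or.inl hwA⟩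
      · obtain ⟨w', hw', hc⟩ := ih (m - w) (by omega) hw hwA rfl
        exact ⟨w', by omega, hc⟩
    · omega
    · exact ⟨w, hyw, Or.inr hw⟩

lemma IsLocalMin.not_cross (hm : 4 ≤ m) (hS : NatTriangulation m S) (hA : A ⊆ S)
    (hS' : NatTriangulation m S') (hA' : A ⊆ S') (hmin' : IsLocalMin m A S')
    {x y p q : ℕ} (h : (x, y) ∈ S) (h' : (p, q) ∈ S') (hxp : x < p) (hpy : p < y) : q ≤ y := by
  by_contra hyq
  have hpq : (p, q) ∉ A := fun hmem => hyq (hS.noncrossing _ _ _ _ h (hA hmem) hxp hpy)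
  obtain ⟨w, hqw, hw | hw⟩ := hS'.exists_fan_end hm hA' hmin' h' hpq
  · have := hS.noncrossing _ _ _ _ h (hA hw) hxp hpy
    omega
  · omega

lemma IsLocalMin.subset (hm : 4 ≤ m) (hS : NatTriangulation m S) (hA : A ⊆ S)
    (hmin : IsLocalMin m A S) (hS' : NatTriangulation m S') (hA' : A ⊆ S')
    (hmin' : IsLocalMin m A S') : S ⊆ S' := by
  rintro ⟨x, y⟩ h
  exact hS'.maximal hm (hS.chord _ h)
    (fun i j hij h1 h2 => hmin.not_cross hm hS' hA' hS hA hij h h1 h2)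
    (fun i j hij h1 h2 => hmin'.not_cross hm hS hA hS' hA' h hij h1 h2)

lemma IsLocalMin.weight_lt (hm : 4 ≤ m) (hS : NatTriangulation m S) (hA : A ⊆ S)
    (hmin : IsLocalMin m A S) (hS' : NatTriangulation m S') (hA' : A ⊆ S') (hne : S' ≠ S) :
    weight S < weight S' := by
  induction hn : weight S' using Nat.strong_induction_on generalizing S' with
  | _ n ih =>
    by_cases hmin' : IsLocalMin m A S'
    · exact absurd ((hmin'.subset hm hS' hA' hS hA hmin).antisymm
        (hmin.subset hm hS hA hS' hA' hmin')) hne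
    · simp only [IsLocalMin, not_forall, not_le] at hmin'
      obtain ⟨T, hT, hAT, -, hlt⟩ := hmin'
      by_cases hTS : T = S
      · subst hTS
        omega
      · exact (ih _ (by omega) hT hAT hTS rfl).trans (by omega)

lemma exists_flip_lt (hm : 4 ≤ m) (hS : NatTriangulation m S) (hS' : NatTriangulation m S')
    (hne : S' ≠ S) (hle : weight S' ≤ weight S) :
    ∃ T, NatTriangulation m T ∧ S' ∩ S ⊆ T ∧ (T ∩ S).card = m - 4 ∧ weight T < weight S := by
  by_contra! hcon
  have hmin : IsLocalMin m (S' ∩ S) S := hcon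
  exact (hmin.weight_lt hm hS Finset.inter_subset_right hS' Finset.inter_subset_left hne).not_ge hle

end NatTriangulation

/-- The diagonal of `P_m` given by a pair of natural numbers. -/
def toDiag (m : ℕ) (p : ℕ × ℕ) : Sym2 (ZMod m) := s((p.1 : ZMod m), (p.2 : ZMod m))

lemma natCast_inj_of_lt {m a b : ℕ} (ha : a < m) (hb : b < m) :
    (a : ZMod m) = b ↔ a = b := by
  rw [ZMod.natCast_eq_natCast_iff', Nat.mod_eq_of_lt ha, Nat.mod_eq_of_lt hb]

lemma val_natCast_sub {m a b : ℕ} (ha : a < m) (hb : b < m) :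
    ((b : ZMod m) - (a : ZMod m)).val = if a ≤ b then b - a else m + b - a := by
  split_ifs with h
  · rw [← Nat.cast_sub h, ZMod.val_natCast_of_lt (by omega)]
  · have : (b : ZMod m) - (a : ZMod m) = ((m + b - a : ℕ) : ZMod m) := by
      rw [Nat.cast_sub (by omega)]
      simp
    rw [this, ZMod.val_natCast_of_lt (by omega)]

lemma toDiag_injOn {m : ℕ} : Set.InjOn (toDiag m) {p | p.1 < p.2 ∧ p.2 < m} := by
  rintro ⟨a, b⟩ ⟨h1, h2⟩ ⟨c, d⟩ ⟨h3, h4⟩ h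
  dsimp only at h1 h2 h3 h4
  rw [toDiag, toDiag, Sym2.eq_iff, natCast_inj_of_lt (by omega) (by omega),
    natCast_inj_of_lt (by omega) (by omega), natCast_inj_of_lt (by omega) (by omega),
    natCast_inj_of_lt (by omega) (by omega)] at h
  ext <;> dsimp only <;> omega

lemma sub_natCast_iff {m a b : ℕ} (hm : 4 ≤ m) (ha : a < m) (hb : b < m) :
    ((b : ZMod m) - a ≠ 0 ∧ (b : ZMod m) - a ≠ 1 ∧ (b : ZMod m) - a ≠ -1) ↔
      a ≠ b ∧ a + 1 ≠ b ∧ b + 1 ≠ a ∧ ¬ (a = 0 ∧ b + 1 = m) ∧ ¬ (b = 0 ∧ a + 1 = m) := by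
  have : NeZero m := ⟨by omega⟩
  have hneg : (-1 : ZMod m) = ((m - 1 : ℕ) : ZMod m) := by
    rw [Nat.cast_sub (by omega)]
    simp
  have h0 : ((b : ZMod m) - a).val = 0 ↔ (b : ZMod m) - a = 0 := ZMod.val_eq_zero _
  have h1 : ((b : ZMod m) - a).val = 1 ↔ (b : ZMod m) - a = 1 := by
    rw [← (ZMod.val_injective m).eq_iff, ZMod.val_one'' (by omega)]
  have h2 : ((b : ZMod m) - a).val = m - 1 ↔ (b : ZMod m) - a = -1 := by
    rw [← (ZMod.val_injective m).eq_iff, hneg, ZMod.val_natCast_of_lt (by omega)]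
  rw [ne_eq, ne_eq, ne_eq, ← h0, ← h1, ← h2, val_natCast_sub ha hb]
  split_ifs <;> omega

lemma isDiag_iff_s9 {m : ℕ} (hm : 4 ≤ m) (e : Sym2 (ZMod m)) :
    IsDiag m e ↔ ∃ p, IsChord m p ∧ toDiag m p = e := by
  have : NeZero m := ⟨by omega⟩
  constructor
  · rintro ⟨i, j, rfl, h⟩
    have hi := ZMod.val_lt i
    have hj := ZMod.val_lt j
    rw [← ZMod.natCast_zmod_val i, ← ZMod.natCast_zmod_val j, sub_natCast_iff hm hi hj] at h
    rcases lt_or_ge i.val j.val with hij | hij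
    · refine ⟨(i.val, j.val), ⟨?_, ?_, ?_⟩, ?_⟩
      iterate 3 (dsimp only; omega)
      simp [toDiag]
    · refine ⟨(j.val, i.val), ⟨?_, ?_, ?_⟩, ?_⟩
      iterate 3 (dsimp only; omega)
      simp [toDiag, Sym2.eq_swap]
  · rintro ⟨⟨a, b⟩, ⟨h1, h2, h3⟩, rfl⟩
    dsimp only at h1 h2 h3
    refine ⟨a, b, rfl, (sub_natCast_iff hm (by omega) h2).2 ?_⟩
    omega

lemma strictBtw_natCast {m a b c : ℕ} (ha : a < m) (hb : b < m) (hc : c < m) :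
    StrictBtw m a b c ↔ (a < b ∧ b < c) ∨ (b < c ∧ c < a) ∨ (c < a ∧ a < b) := by
  rw [StrictBtw, val_natCast_sub ha hb, val_natCast_sub ha hc]
  split_ifs <;> omega

lemma cross_iff_s9 {m : ℕ} {e f : Sym2 (ZMod m)} :
    Cross m e f ↔ ∃ a b c d : ZMod m, e = s(a, b) ∧ f = s(c, d) ∧
      a ≠ b ∧ a ≠ c ∧ a ≠ d ∧ b ≠ c ∧ b ≠ d ∧ c ≠ d ∧
      ((StrictBtw m a c b ∧ ¬ StrictBtw m a d b) ∨ (StrictBtw m a d b ∧ ¬ StrictBtw m a c b)) :=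
  Iff.rfl

lemma cross_toDiag {m i j k l : ℕ} (hij : i < j) (hj : j < m) (hkl : k < l) (hl : l < m) :
    Cross m (toDiag m (i, j)) (toDiag m (k, l)) ↔
      (i < k ∧ k < j ∧ j < l) ∨ (k < i ∧ i < l ∧ l < j) := by
  have hi : i < m := by omega
  have hk : k < m := by omega
  rw [cross_iff_s9]
  constructor
  · rintro ⟨a, b, c, d, he, hf, h⟩
    rw [toDiag, Sym2.eq_iff] at he hf
    rcases he with ⟨rfl, rfl⟩ | ⟨rfl, rfl⟩ <;> rcases hf with ⟨rfl, rfl⟩ | ⟨rfl, rfl⟩ <;>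
      simp only [strictBtw_natCast, natCast_inj_of_lt, hi, hj, hk, hl, ne_eq] at h <;> omega
  · intro h
    refine ⟨i, j, k, l, rfl, rfl, ?_⟩
    simp only [strictBtw_natCast, natCast_inj_of_lt, hi, hj, hk, hl, ne_eq]
    omega

lemma isTriangulation_image_iff {m : ℕ} (hm : 4 ≤ m) {S : Finset (ℕ × ℕ)}
    (hS : ∀ p ∈ S, IsChord m p) :
    IsTriangulation m (S.image (toDiag m)) ↔ NatTriangulation m S := by
  have hlt : ∀ p ∈ S, p.1 < p.2 ∧ p.2 < m := fun p hp => by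
    have := hS p hp
    unfold IsChord at this
    omega
  have hinj : Set.InjOn (toDiag m) S := toDiag_injOn.mono hlt
  have hcard : (S.image (toDiag m)).card = S.card := Finset.card_image_of_injOn hinj
  constructor
  · rintro ⟨h1, -, h3⟩
    refine ⟨hcard ▸ h1, hS, fun i j k l hi hk hik hkj => ?_⟩
    by_contra hjl
    refine h3 _ (Finset.mem_image_of_mem _ hi) _ (Finset.mem_image_of_mem _ hk) ?_ ?_
    · intro he
      have := congrArg Prod.fst (hinj hi hk he)
      dsimp only at this
      omega
    · rw [cross_toDiag (hlt _ hi).1 (hlt _ hi).2 (hlt _ hk).1 (hlt _ hk).2]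
      omega
  · rintro ⟨h1, -, h3⟩
    refine ⟨hcard.trans h1, ?_, ?_⟩
    · intro e he
      obtain ⟨p, hp, rfl⟩ := Finset.mem_image.1 he
      exact (isDiag_iff_s9 hm _).2 ⟨p, hS p hp, rfl⟩
    · intro e he f hf _ hc
      obtain ⟨⟨i, j⟩, hi, rfl⟩ := Finset.mem_image.1 he
      obtain ⟨⟨k, l⟩, hk, rfl⟩ := Finset.mem_image.1 hf
      rw [cross_toDiag (hlt _ hi).1 (hlt _ hi).2 (hlt _ hk).1 (hlt _ hk).2] at hc
      have a1 := h3 _ _ _ _ hi hk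
      have a2 := h3 _ _ _ _ hk hi
      omega

lemma IsTriangulation.exists_image_eq {m : ℕ} (hm : 4 ≤ m) {T : Finset (Sym2 (ZMod m))}
    (hT : IsTriangulation m T) : ∃ S, NatTriangulation m S ∧ S.image (toDiag m) = T := by
  have hsub : (T : Set (Sym2 (ZMod m))) ⊆ toDiag m '' {p | IsChord m p} := fun e he =>
    (isDiag_iff_s9 hm e).1 (hT.2.1 e he)
  obtain ⟨S, hS, rfl⟩ := Finset.subset_set_image_iff.1 hsub
  exact ⟨S, (isTriangulation_image_iff hm hS).1 hT, rfl⟩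

lemma NatTriangulation.finite (m : ℕ) : {S | NatTriangulation m S}.Finite := by
  refine (Finset.finite_toSet (Finset.range m ×ˢ Finset.range m).powerset).subset fun S hS => ?_
  refine Finset.mem_coe.2 (Finset.mem_powerset.2 fun p hp => ?_)
  have := hS.bounds hp
  rw [Finset.mem_product, Finset.mem_range, Finset.mem_range]
  omega

lemma exists_monotone_enumeration {α : Type*} {s : Set α} (hs : s.Finite) (φ : α → ℕ) :
    ∃ N : ℕ, ∃ f : Fin N → α, Function.Injective f ∧ Set.range f = s ∧ Monotone (φ ∘ f) := by
  have := hs.fintype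
  let e := (Fintype.equivFin s).symm
  let σ := Tuple.sort fun i => φ (e i)
  refine ⟨Fintype.card s, fun i => e (σ i), ?_, ?_, Tuple.monotone_sort fun i => φ (e i)⟩
  · exact Subtype.val_injective.comp (e.injective.comp σ.injective)
  · ext x
    constructor
    · rintro ⟨i, rfl⟩
      exact (e (σ i)).2
    · intro hx
      exact ⟨σ.symm (e.symm ⟨x, hx⟩), by simp⟩

/-- For `P_m` (`m ≥ 4`), there is an enumeration `T_1, …, T_N` of all
triangulations such that for all `j < k` there exists `i < k` with
`|T_i ∩ T_k| = m - 4` and `T_j ∩ T_k ⊆ T_i ∩ T_k` (the arc complex of a convex polygon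
is shellable). -/
theorem arc_complex_shellable (m : ℕ) (hm : 4 ≤ m) :
    ∃ N : ℕ, ∃ f : Fin N → Finset (Sym2 (ZMod m)),
      Function.Injective f ∧
      (∀ i, IsTriangulation m (f i)) ∧
      (∀ T, IsTriangulation m T → ∃ i, f i = T) ∧
      ∀ j k : Fin N, j < k →
        ∃ i : Fin N, i < k ∧ (f i ∩ f k).card = m - 4 ∧ f j ∩ f k ⊆ f i ∩ f k := by
  obtain ⟨N, g, hginj, hrange, hmono⟩ :=
    exists_monotone_enumeration (NatTriangulation.finite m) weight
  have hg : ∀ i, NatTriangulation m (g i) := fun i => hrange.subset ⟨i, rfl⟩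
  have hlt : ∀ i, ((g i : Finset (ℕ × ℕ)) : Set (ℕ × ℕ)) ⊆ {p | p.1 < p.2 ∧ p.2 < m} := by
    intro i p hp
    have := (hg i).bounds hp
    exact ⟨by omega, this.2.1⟩
  have hinter : ∀ i k, (g i).image (toDiag m) ∩ (g k).image (toDiag m) =
      (g i ∩ g k).image (toDiag m) := fun i k =>
    (Finset.image_inter_of_injOn _ _
      (toDiag_injOn.mono (Set.union_subset (hlt i) (hlt k)))).symm
  refine ⟨N, fun i => (g i).image (toDiag m), ?_, ?_, ?_, ?_⟩
  · intro i k hik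
    refine hginj (Finset.coe_injective ((toDiag_injOn.image_eq_image_iff (hlt i) (hlt k)).1 ?_))
    simpa using congrArg (fun T : Finset (Sym2 (ZMod m)) => (T : Set (Sym2 (ZMod m)))) hik
  · exact fun i => (isTriangulation_image_iff hm (hg i).chord).2 (hg i)
  · intro T hT
    obtain ⟨S, hS, rfl⟩ := hT.exists_image_eq hm
    obtain ⟨i, rfl⟩ := hrange.superset hS
    exact ⟨i, rfl⟩
  · intro j k hjk
    obtain ⟨T, hT, hsub, hcard, hw⟩ :=
      (hg k).exists_flip_lt hm (hg j) (fun e => hjk.ne (hginj e)) (hmono hjk.le)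
    obtain ⟨i, rfl⟩ := hrange.superset hT
    refine ⟨i, lt_of_not_ge fun hki => hw.not_ge (hmono hki), ?_, ?_⟩
    · dsimp only
      rw [hinter, Finset.card_image_of_injOn
        (toDiag_injOn.mono fun p hp => hlt i (Finset.mem_inter.1 hp).1), hcard]
    · dsimp only
      rw [hinter, hinter]
      exact Finset.image_subset_image (Finset.subset_inter hsub Finset.inter_subset_right)

end Poly
end

section
/- For any non-trivial bicolouring of the once-punctured convex m-gon P*_m (m ≥ 2), every set of pairwise non-crossing permitted arcs is contained in a permissible triangulation, i.e., in a set of exactly m−1 pairwise non-crossing permitted arcs. (The subcomplex of the arc complex of P*_m spanned by permitted arcs is pure of dimension m−2.) -/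
/-!
Vertices of the once-punctured convex `m`-gon `P*_m` are identified with `ZMod m`.
An arc is an equivalence class `[(a,b)]` of pairs of integers with
`a < b ≤ a + m` and `b - a ≥ 2`, modulo `(a,b) ∼ (a+m, b+m)`.  Each class has a unique
representative with `0 ≤ a < m`; we identify arcs with these canonical representatives,
i.e. with pairs `p : ℤ × ℤ` satisfying `IsPArc m p` below.
Blue is encoded by the Boolean value `true`, red by `false`.
-/

namespace Punc

/-- `p` is (the canonical representative of) an arc of `P*_m`:
`0 ≤ p.1 < m`, `p.1 < p.2 ≤ p.1 + m` and `p.2 - p.1 ≥ 2`. -/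
def IsPArc (m : ℕ) (p : ℤ × ℤ) : Prop :=
  0 ≤ p.1 ∧ p.1 < (m : ℤ) ∧ p.1 + 2 ≤ p.2 ∧ p.2 ≤ p.1 + (m : ℤ)

/-- The arcs `[(a,b)] = p` and `[(c,d)] = q` cross: there is an integer `k` with
`a + km < c < b + km < d` or with `c < a + km < d < b + km`. -/
def PCross (m : ℕ) (p q : ℤ × ℤ) : Prop :=
  ∃ k : ℤ, (p.1 + k * m < q.1 ∧ q.1 < p.2 + k * m ∧ p.2 + k * m < q.2) ∨
    (q.1 < p.1 + k * m ∧ p.1 + k * m < q.2 ∧ q.2 < p.2 + k * m)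

/-- The arc `p` is the maximal arc based at `p.1 mod m`, i.e. `p.2 - p.1 = m`. -/
def IsMaximalArc (m : ℕ) (p : ℤ × ℤ) : Prop :=
  IsPArc m p ∧ p.2 - p.1 = (m : ℤ)

/-- A triangulation of `P*_m`: a set of `m - 1` pairwise non-crossing arcs. -/
def IsPTriangulation (m : ℕ) (T : Finset (ℤ × ℤ)) : Prop :=
  T.card = m - 1 ∧ (∀ p ∈ T, IsPArc m p) ∧
    ∀ p ∈ T, ∀ q ∈ T, p ≠ q → ¬ PCross m p q

/-- A bicolouring: a function from the vertices to {red, blue} attaining both values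
(`true` = blue, `false` = red). -/
def IsBicolouring (m : ℕ) (c : ZMod m → Bool) : Prop :=
  (∃ v, c v = true) ∧ (∃ v, c v = false)

/-- A bicolouring is non-trivial if some arc has both endpoints red. -/
def IsNontrivialBicolouring (m : ℕ) (c : ZMod m → Bool) : Prop :=
  IsBicolouring m c ∧
    ∃ p : ℤ × ℤ, IsPArc m p ∧ c (p.1 : ZMod m) = false ∧ c (p.2 : ZMod m) = false

/-- An arc is permitted if at least one of its endpoints is blue. -/
def Permitted (m : ℕ) (c : ZMod m → Bool) (p : ℤ × ℤ) : Prop :=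
  c (p.1 : ZMod m) = true ∨ c (p.2 : ZMod m) = true

/-- A permissible triangulation: a triangulation all of whose arcs are permitted. -/
def IsPermissible (m : ℕ) (c : ZMod m → Bool) (T : Finset (ℤ × ℤ)) : Prop :=
  IsPTriangulation m T ∧ ∀ p ∈ T, Permitted m c p

/-- Two permissible triangulations are joined in the flip graph of permissible
triangulations: there is a finite sequence of permissible triangulations from one to the
other in which consecutive triangulations share exactly `m - 2` arcs. -/
def PermFlipJoined (m : ℕ) (c : ZMod m → Bool) (T₁ T₂ : Finset (ℤ × ℤ)) : Prop :=
  ∃ n : ℕ, ∃ f : Fin (n + 1) → Finset (ℤ × ℤ),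
    f 0 = T₁ ∧ f (Fin.last n) = T₂ ∧ (∀ i, IsPermissible m c (f i)) ∧
    ∀ i : Fin n, (f i.castSucc ∩ f i.succ).card = m - 2

/-- A set of pairwise non-crossing permitted chords of the interval `[a, b]` extends to a full
triangulation of the polygon with vertices `a, …, b` by permitted chords, the closing chord
`(a, b)` included, as soon as `(a, b)` is itself permitted or is a side. -/
lemma exists_interval_triangulation (blue : ℤ → Prop) (n : ℕ) :
    ∀ (a b : ℤ), b - a = n + 1 → (n = 0 ∨ blue a ∨ blue b) → ∀ N : Finset (ℤ × ℤ),
    (∀ p ∈ N, a ≤ p.1 ∧ p.1 + 2 ≤ p.2 ∧ p.2 ≤ b ∧ (blue p.1 ∨ blue p.2)) →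
    (∀ p ∈ N, ∀ q ∈ N, ¬ (p.1 < q.1 ∧ q.1 < p.2 ∧ p.2 < q.2)) →
    ∃ T : Finset (ℤ × ℤ), N ⊆ T ∧ T.card = n ∧
      (∀ p ∈ T, a ≤ p.1 ∧ p.1 + 2 ≤ p.2 ∧ p.2 ≤ b ∧ (blue p.1 ∨ blue p.2)) ∧
      (∀ p ∈ T, ∀ q ∈ T, ¬ (p.1 < q.1 ∧ q.1 < p.2 ∧ p.2 < q.2)) := by
  induction n using Nat.strong_induction_on with
  | _ n ih =>
  intro a b hab hblue N hN hcross
  rcases Nat.eq_zero_or_pos n with rfl | hn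
  · refine ⟨N, subset_rfl, ?_, hN, hcross⟩
    rw [Finset.card_eq_zero, Finset.eq_empty_iff_forall_notMem]
    intro p hp
    have := hN p hp
    push_cast at hab
    omega
  obtain ⟨c, hac, hcb, hunder, hl, hr⟩ : ∃ c, a < c ∧ c < b ∧
      (∀ p ∈ N, p.1 < c → c < p.2 → p = (a, b)) ∧
      (c = a + 1 ∨ blue a ∨ blue c) ∧ (c = b - 1 ∨ blue c ∨ blue b) := by
    rcases hblue.resolve_left hn.ne' with ha | hb
    · -- the third vertex of the triangle on `(a, b)` is the neighbour of `b`
      by_cases hF : ∃ x, a < x ∧ (x, b) ∈ N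
      · obtain ⟨x, ⟨hx, hxN⟩, hmin⟩ := Int.exists_least_of_bdd
          (P := fun x => a < x ∧ (x, b) ∈ N) ⟨a, fun z hz => hz.1.le⟩ hF
        have h1 := hN _ hxN
        refine ⟨x, hx, by grind, ?_, Or.inr (Or.inl ha), Or.inr h1.2.2.2⟩
        intro p hp h2 h3
        have h4 := hN p hp
        have h5 := hcross p hp _ hxN
        have h6 : p.2 = b := by grind
        have h7 : ¬ a < p.1 := fun h => by
          have := hmin p.1 ⟨h, by rw [← h6]; exact hp⟩
          omega
        ext <;> grind
      · refine ⟨b - 1, by omega, by omega, ?_, Or.inr (Or.inl ha), Or.inl rfl⟩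
        intro p hp h2 h3
        have h4 := hN p hp
        have h6 : p.2 = b := by omega
        have h7 : ¬ a < p.1 := fun h => hF ⟨p.1, h, by rw [← h6]; exact hp⟩
        ext <;> grind
    · by_cases hF : ∃ x, x < b ∧ (a, x) ∈ N
      · obtain ⟨x, ⟨hx, hxN⟩, hmax⟩ := Int.exists_greatest_of_bdd
          (P := fun x => x < b ∧ (a, x) ∈ N) ⟨b, fun z hz => hz.1.le⟩ hF
        have h1 := hN _ hxN
        refine ⟨x, by grind, hx, ?_, Or.inr h1.2.2.2, Or.inr (Or.inr hb)⟩
        intro p hp h2 h3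
        have h4 := hN p hp
        have h5 := hcross _ hxN p hp
        have h6 : p.1 = a := by grind
        have h7 : ¬ p.2 < b := fun h => by
          have := hmax p.2 ⟨h, by rw [← h6]; exact hp⟩
          omega
        ext <;> grind
      · refine ⟨a + 1, by omega, by omega, ?_, Or.inl rfl, Or.inr (Or.inr hb)⟩
        intro p hp h2 h3
        have h4 := hN p hp
        have h6 : p.1 = a := by omega
        have h7 : ¬ p.2 < b := fun h => hF ⟨p.2, h, by rw [← h6]; exact hp⟩
        ext <;> grind
  obtain ⟨L, hNL, hLcard, hL, hLcross⟩ := ih (c - a - 1).toNat (by omega) a c (by omega)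
    (hl.imp (by omega) id) (N.filter fun p => p.2 ≤ c)
    (by grind) (by grind)
  obtain ⟨R, hNR, hRcard, hR, hRcross⟩ := ih (b - c - 1).toNat (by omega) c b (by omega)
    (hr.imp (by omega) id) (N.filter fun p => c ≤ p.1)
    (by grind) (by grind)
  have hdisj : Disjoint L R := by
    rw [Finset.disjoint_left]
    intro p hp hq
    have := hL p hp
    have := hR p hq
    omega
  have hab_notMem : (a, b) ∉ L ∪ R := by
    rw [Finset.mem_union]
    rintro (h | h)
    · have := (hL _ h).2.2.1
      grind
    · have := (hR _ h).1
      grind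
  refine ⟨insert (a, b) (L ∪ R), ?_, ?_, ?_, ?_⟩
  · intro p hp
    rw [Finset.mem_insert, Finset.mem_union]
    by_cases h1 : p.2 ≤ c
    · exact Or.inr (Or.inl (hNL (Finset.mem_filter.2 ⟨hp, h1⟩)))
    by_cases h2 : c ≤ p.1
    · exact Or.inr (Or.inr (hNR (Finset.mem_filter.2 ⟨hp, h2⟩)))
    · exact Or.inl (hunder p hp (by omega) (by omega))
  · rw [Finset.card_insert_of_notMem hab_notMem, Finset.card_union_of_disjoint hdisj]
    omega
  · intro p hp
    rw [Finset.mem_insert, Finset.mem_union] at hp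
    rcases hp with rfl | hp | hp
    · exact ⟨le_rfl, by grind, le_rfl, hblue.resolve_left hn.ne'⟩
    · have := hL p hp
      exact ⟨this.1, this.2.1, by omega, this.2.2.2⟩
    · have := hR p hp
      exact ⟨by omega, this.2.1, this.2.2.1, this.2.2.2⟩
  · intro p hp q hq
    rw [Finset.mem_insert, Finset.mem_union] at hp hq
    rcases hp with rfl | hp | hp <;> rcases hq with rfl | hq | hq
    · grind
    · have := hL q hq
      grind
    · have := hR q hq
      grind
    · have := hL p hp
      grind
    · exact hLcross p hp q hq
    · have := hL p hp
      have := hR q hq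
      omega
    · have := hR p hp
      grind
    · have := hL q hq
      have := hR p hp
      omega
    · exact hRcross p hp q hq

/-- The vertex `v` lies strictly under some integer translate of `p`. -/
def Covers (m : ℕ) (p : ℤ × ℤ) (v : ℤ) : Prop :=
  ∃ k : ℤ, p.1 + k * m < v ∧ v < p.2 + k * m

lemma Covers.add_period {m : ℕ} {p : ℤ × ℤ} {v : ℤ} (h : Covers m p v) (j : ℤ) :
    Covers m p (v + j * m) := by
  obtain ⟨k, h1, h2⟩ := h
  exact ⟨k + j, by linarith, by linarith⟩

/-- The endpoints of an arc of maximal length are not covered by a non-crossing arc. -/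
lemma not_covers_endpoints {m : ℕ} {p q : ℤ × ℤ} (hp : IsPArc m p)
    (hlen : q.2 - q.1 ≤ p.2 - p.1) (hcross : p ≠ q → ¬ PCross m q p) :
    ¬ Covers m q p.1 ∧ ¬ Covers m q p.2 := by
  obtain ⟨-, -, -, hp4⟩ := hp
  by_cases hpq : p = q
  · subst hpq
    constructor
    · rintro ⟨k, h1, h2⟩
      have : k ≤ -1 := by
        by_contra! h
        have : 0 ≤ k := by omega
        nlinarith [Int.natCast_nonneg m]
      nlinarith [Int.natCast_nonneg m]
    · rintro ⟨k, h1, h2⟩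
      have : 1 ≤ k := by
        by_contra! h
        have : k ≤ 0 := by omega
        nlinarith [Int.natCast_nonneg m]
      nlinarith [Int.natCast_nonneg m]
  · have h := hcross hpq
    constructor
    · rintro ⟨k, h1, h2⟩
      exact h ⟨k, Or.inl ⟨h1, h2, by linarith⟩⟩
    · rintro ⟨k, h1, h2⟩
      exact h ⟨k, Or.inr ⟨by linarith, h1, h2⟩⟩

/-- Some blue vertex is visible from the puncture. -/
lemma exists_blue_not_covered {m : ℕ} (hm : 2 ≤ m) {c : ZMod m → Bool}
    (hc : ∃ v, c v = true) {S : Finset (ℤ × ℤ)}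
    (hSarc : ∀ p ∈ S, IsPArc m p ∧ Permitted m c p)
    (hScross : ∀ p ∈ S, ∀ q ∈ S, p ≠ q → ¬ PCross m p q) :
    ∃ v : ℤ, 0 ≤ v ∧ v < m ∧ c (v : ZMod m) = true ∧ ∀ p ∈ S, ¬ Covers m p v := by
  suffices h : ∃ v : ℤ, c (v : ZMod m) = true ∧ ∀ p ∈ S, ¬ Covers m p v by
    obtain ⟨v, hv, hS⟩ := h
    have hm0 : (0 : ℤ) < m := by omega
    have hdiv : v % m + v / m * m = v := Int.emod_add_ediv_mul v m
    refine ⟨v % m, Int.emod_nonneg _ hm0.ne', Int.emod_lt_of_pos _ hm0, ?_, ?_⟩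
    · rw [← hv, ZMod.intCast_mod]
    · intro p hp h
      apply hS p hp
      rw [← hdiv]
      exact h.add_period _
  rcases S.eq_empty_or_nonempty with rfl | hne
  · obtain ⟨v, hv⟩ := hc
    obtain ⟨z, rfl⟩ := ZMod.intCast_surjective v
    exact ⟨z, hv, by simp⟩
  · obtain ⟨p, hp, hmax⟩ := S.exists_max_image (fun p => p.2 - p.1) hne
    have h : ∀ q ∈ S, ¬ Covers m q p.1 ∧ ¬ Covers m q p.2 := fun q hq =>
      not_covers_endpoints (hSarc p hp).1 (hmax q hq) fun hne => hScross q hq p hp hne.symm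
    rcases (hSarc p hp).2 with hb | hb
    · exact ⟨p.1, hb, fun q hq => (h q hq).1⟩
    · exact ⟨p.2, hb, fun q hq => (h q hq).2⟩

/-- The translate of an arc that starts in `[v, v + m)`. -/
def liftArc (m : ℕ) (v : ℤ) (p : ℤ × ℤ) : ℤ × ℤ :=
  if p.1 < v then (p.1 + m, p.2 + m) else p

/-- The translate of an arc starting in `[0, 2 * m)` that starts in `[0, m)`. -/
def canonArc (m : ℕ) (p : ℤ × ℤ) : ℤ × ℤ :=
  if p.1 < m then p else (p.1 - m, p.2 - m)

lemma canonArc_liftArc {m : ℕ} {v : ℤ} {p : ℤ × ℤ} (hp : IsPArc m p) :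
    canonArc m (liftArc m v p) = p := by
  obtain ⟨h1, h2, -, -⟩ := hp
  unfold canonArc liftArc
  ext <;> grind

lemma liftArc_mem_interval {m : ℕ} {v : ℤ} {p : ℤ × ℤ} (hp : IsPArc m p)
    (hv0 : 0 ≤ v) (hvm : v < m) (hcov : ¬ Covers m p v) :
    v ≤ (liftArc m v p).1 ∧ (liftArc m v p).1 + 2 ≤ (liftArc m v p).2 ∧
      (liftArc m v p).2 ≤ v + m := by
  obtain ⟨h1, h2, h3, h4⟩ := hp
  unfold liftArc
  split_ifs with h
  · have : ¬ v < p.2 := fun h' => hcov ⟨0, by simpa using h, by simpa using h'⟩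
    dsimp only
    omega
  · have : ¬ (p.1 - m < v ∧ v < p.2 - m) := fun h' =>
      hcov ⟨-1, by linarith [h'.1], by linarith [h'.2]⟩
    omega

lemma exists_liftArc_eq (m : ℕ) (v : ℤ) (p : ℤ × ℤ) :
    ∃ k : ℤ, liftArc m v p = (p.1 + k * m, p.2 + k * m) := by
  unfold liftArc
  split_ifs
  · exact ⟨1, by simp⟩
  · exact ⟨0, by simp⟩

lemma exists_canonArc_eq (m : ℕ) (p : ℤ × ℤ) :
    ∃ k : ℤ, canonArc m p = (p.1 + k * m, p.2 + k * m) := by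
  unfold canonArc
  split_ifs
  · exact ⟨0, by simp⟩
  · exact ⟨-1, by ext <;> dsimp only <;> ring⟩

lemma permitted_translate {m : ℕ} {c : ZMod m → Bool} {p : ℤ × ℤ} (k : ℤ) :
    Permitted m c (p.1 + k * m, p.2 + k * m) ↔ Permitted m c p := by
  simp [Permitted]

lemma pCross_translate {m : ℕ} {p q : ℤ × ℤ} (i j : ℤ) :
    PCross m (p.1 + i * m, p.2 + i * m) (q.1 + j * m, q.2 + j * m) ↔ PCross m p q := by
  constructor
  · rintro ⟨k, h⟩
    refine ⟨k + i - j, h.imp ?_ ?_⟩ <;> rintro ⟨h1, h2, h3⟩ <;> dsimp only at h1 h2 h3 <;>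
      refine ⟨?_, ?_, ?_⟩ <;> linarith
  · rintro ⟨k, h⟩
    refine ⟨k - i + j, h.imp ?_ ?_⟩ <;> rintro ⟨h1, h2, h3⟩ <;> dsimp only <;>
      refine ⟨?_, ?_, ?_⟩ <;> linarith

/-- Inside one period, crossing on the punctured disc is crossing of intervals. -/
lemma PCross.linear {m : ℕ} {v : ℤ} {p q : ℤ × ℤ} (hp1 : v ≤ p.1) (hp2 : p.2 ≤ v + m)
    (hq1 : v ≤ q.1) (hq2 : q.2 ≤ v + m) (h : PCross m p q) :
    (p.1 < q.1 ∧ q.1 < p.2 ∧ p.2 < q.2) ∨ (q.1 < p.1 ∧ p.1 < q.2 ∧ q.2 < p.2) := by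
  obtain ⟨k, h⟩ := h
  have hk : k = 0 := by
    by_contra hk
    rcases lt_or_gt_of_ne hk with hk | hk
    · have : k * (m : ℤ) ≤ -m := by nlinarith [Int.natCast_nonneg m]
      omega
    · have : (m : ℤ) ≤ k * m := by nlinarith [Int.natCast_nonneg m]
      omega
  simpa [hk] using h

/-- For any non-trivial bicolouring of `P*_m` (`m ≥ 2`), every set of
pairwise non-crossing permitted arcs is contained in a permissible triangulation. -/
theorem permitted_subcomplex_pure (m : ℕ) (hm : 2 ≤ m) (c : ZMod m → Bool)
    (hc : IsNontrivialBicolouring m c)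
    (S : Finset (ℤ × ℤ))
    (hSarc : ∀ p ∈ S, IsPArc m p ∧ Permitted m c p)
    (hScross : ∀ p ∈ S, ∀ q ∈ S, p ≠ q → ¬ PCross m p q) :
    ∃ T : Finset (ℤ × ℤ), IsPermissible m c T ∧ S ⊆ T := by
  obtain ⟨v, hv0, hvm, hvblue, hcov⟩ := exists_blue_not_covered hm hc.1.1 hSarc hScross
  obtain ⟨T, hST, hTcard, hT, hTcross⟩ := exists_interval_triangulation
    (fun x => c (x : ZMod m) = true) (m - 1) v (v + m) (by omega) (Or.inr (Or.inl hvblue))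
    (S.image (liftArc m v))
    (by
      simp only [Finset.forall_mem_image]
      intro p hp
      obtain ⟨h1, h2, h3⟩ := liftArc_mem_interval (hSarc p hp).1 hv0 hvm (hcov p hp)
      refine ⟨h1, h2, h3, ?_⟩
      obtain ⟨k, hk⟩ := exists_liftArc_eq m v p
      rw [hk]
      exact (permitted_translate k).2 (hSarc p hp).2)
    (by
      simp only [Finset.forall_mem_image]
      intro p hp q hq h
      have hpq : p ≠ q := by
        rintro rfl
        exact h.1.false
      apply hScross p hp q hq hpq
      obtain ⟨i, hi⟩ := exists_liftArc_eq m v p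
      obtain ⟨j, hj⟩ := exists_liftArc_eq m v q
      rw [← pCross_translate i j, ← hi, ← hj]
      exact ⟨0, Or.inl (by simpa using h)⟩)
  refine ⟨T.image (canonArc m), ⟨⟨?_, ?_, ?_⟩, ?_⟩, ?_⟩
  · rw [Finset.card_image_of_injOn, hTcard]
    intro p hp q hq h
    have := hT p hp
    have := hT q hq
    have h1 := congrArg Prod.fst h
    have h2 := congrArg Prod.snd h
    unfold canonArc at h1 h2
    ext <;> grind
  · simp only [Finset.forall_mem_image]
    intro p hp
    have := hT p hp
    unfold canonArc IsPArc
    split_ifs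
    · omega
    · dsimp only
      omega
  · simp only [Finset.forall_mem_image]
    intro p hp q hq _ h
    obtain ⟨i, hi⟩ := exists_canonArc_eq m p
    obtain ⟨j, hj⟩ := exists_canonArc_eq m q
    rw [hi, hj, pCross_translate] at h
    have h1 := hT p hp
    have h2 := hT q hq
    rcases h.linear h1.1 h1.2.2.1 h2.1 h2.2.2.1 with h | h
    · exact hTcross p hp q hq h
    · exact hTcross q hq p hp h
  · simp only [Finset.forall_mem_image]
    intro p hp
    obtain ⟨i, hi⟩ := exists_canonArc_eq m p
    rw [hi, permitted_translate]
    exact (hT p hp).2.2.2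
  · intro p hp
    rw [← canonArc_liftArc (v := v) (hSarc p hp).1]
    exact Finset.mem_image_of_mem _ (hST (Finset.mem_image_of_mem _ hp))

end Punc
end

section
/- For any non-trivial bicolouring of the once-punctured convex m-gon P*_m (m ≥ 2), every set of m−2 pairwise non-crossing permitted arcs is contained in at least one and at most two permissible triangulations. -/
/-!
Vertices of the once-punctured convex `m`-gon `P*_m` are identified with `ZMod m`.
An arc is an equivalence class `[(a,b)]` of pairs of integers with
`a < b ≤ a + m` and `b - a ≥ 2`, modulo `(a,b) ∼ (a+m, b+m)`.  Each class has a unique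
representative with `0 ≤ a < m`; we identify arcs with these canonical representatives,
i.e. with pairs `p : ℤ × ℤ` satisfying `IsPArc m p` below.
Blue is encoded by the Boolean value `true`, red by `false`.
-/

namespace Punc

/-- The chords `p` and `q` of a polygon with integer vertices cross, `p` starting first. -/
def LCross (p q : ℤ × ℤ) : Prop := p.1 < q.1 ∧ q.1 < p.2 ∧ p.2 < q.2

/-- The chords `p` and `q` do not cross. -/
def Compat (p q : ℤ × ℤ) : Prop := ¬ LCross p q ∧ ¬ LCross q p

/-- `p` is a chord of the polygon with vertices `lo, …, hi`; the chord `(lo, hi)` is allowed. -/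
def IsChord (lo hi : ℤ) (p : ℤ × ℤ) : Prop := lo ≤ p.1 ∧ p.1 + 2 ≤ p.2 ∧ p.2 ≤ hi

/-- `D` is a set of pairwise non-crossing chords of the polygon with vertices `lo, …, hi`. -/
def IsDissection (lo hi : ℤ) (D : Finset (ℤ × ℤ)) : Prop :=
  (∀ p ∈ D, IsChord lo hi p) ∧ ∀ p ∈ D, ∀ q ∈ D, ¬ LCross p q

/-- Every chord compatible with `D` belongs to `D`. -/
def IsSaturated (lo hi : ℤ) (D : Finset (ℤ × ℤ)) : Prop :=
  ∀ e, IsChord lo hi e → (∀ q ∈ D, Compat e q) → e ∈ D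

/-- `t` is the last vertex before `p.2` joined to `p.1` by a polygon edge or a chord of `D`. -/
def IsApex (D : Finset (ℤ × ℤ)) (p : ℤ × ℤ) (t : ℤ) : Prop :=
  p.1 < t ∧ t < p.2 ∧ (t = p.1 + 1 ∨ (p.1, t) ∈ D) ∧ ∀ s, t < s → s < p.2 → (p.1, s) ∉ D

theorem exists_isApex (D : Finset (ℤ × ℤ)) {p : ℤ × ℤ} (hp : p.1 + 2 ≤ p.2) :
    ∃ t, IsApex D p t := by
  obtain ⟨t, ⟨h1, h2, h3⟩, h4⟩ := Int.exists_greatest_of_bdd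
    (P := fun t => p.1 < t ∧ t < p.2 ∧ (t = p.1 + 1 ∨ (p.1, t) ∈ D))
    ⟨p.2, fun z hz => hz.2.1.le⟩ ⟨p.1 + 1, by omega, by omega, Or.inl rfl⟩
  refine ⟨t, h1, h2, h3, fun s hs hs' hm => ?_⟩
  have := h4 s ⟨by omega, hs', Or.inr hm⟩
  omega

theorem IsApex.eq_of_eq {lo hi : ℤ} {D : Finset (ℤ × ℤ)} (hD : IsDissection lo hi D)
    {p q : ℤ × ℤ} (hp : p ∈ D) (hq : q ∈ D) {t : ℤ} (hpt : IsApex D p t) (hqt : IsApex D q t) :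
    p = q := by
  wlog h : p.1 < q.1 ∨ p.1 = q.1 ∧ p.2 ≤ q.2 generalizing p q
  · exact (this hq hp hqt hpt (by omega)).symm
  obtain ⟨a, b⟩ := p
  obtain ⟨a', b'⟩ := q
  obtain ⟨h1, h2, h3, h4⟩ := hpt
  obtain ⟨h1', h2', h3', h4'⟩ := hqt
  simp only at *
  rcases h with h | ⟨rfl, h⟩
  · rcases h3 with h3 | h3
    · omega
    · exact (hD.2 _ h3 _ hq ⟨h, h1', h2'⟩).elim
  · rcases h.lt_or_eq with h | rfl
    · exact (h4' b h2 h hp).elim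
    · rfl

theorem IsDissection.card_le {lo hi : ℤ} {D : Finset (ℤ × ℤ)} (hD : IsDissection lo hi D) :
    D.card ≤ (hi - lo - 1).toNat := by
  choose! f hf using fun p (hp : p ∈ D) => exists_isApex D (hD.1 p hp).2.1
  rw [← Int.card_Ioo]
  refine Finset.card_le_card_of_injOn f (fun p hp => ?_) fun p hp q hq h => ?_
  · have h1 := hf p hp
    have h2 := hD.1 p hp
    simp only [Finset.coe_Ioo, Set.mem_Ioo]
    exact ⟨h2.1.trans_lt h1.1, h1.2.1.trans_le h2.2.2⟩
  · exact IsApex.eq_of_eq hD hp hq (hf p hp) (h ▸ hf q hq)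

theorem IsDissection.insert_chord {lo hi : ℤ} {D : Finset (ℤ × ℤ)} (hD : IsDissection lo hi D)
    {e : ℤ × ℤ} (he : IsChord lo hi e) (hc : ∀ q ∈ D, Compat e q) :
    IsDissection lo hi (insert e D) := by
  refine ⟨fun p hp => ?_, fun p hp q hq => ?_⟩
  · rcases Finset.mem_insert.1 hp with rfl | hp
    exacts [he, hD.1 p hp]
  · rcases Finset.mem_insert.1 hp with rfl | hp' <;> rcases Finset.mem_insert.1 hq with rfl | hq'
    · exact fun h => lt_irrefl _ h.1
    · exact (hc q hq').1
    · exact (hc p hp').2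
    · exact hD.2 p hp' q hq'

theorem IsDissection.isSaturated {lo hi : ℤ} {D : Finset (ℤ × ℤ)} (hD : IsDissection lo hi D)
    (hcard : (D.card : ℤ) = hi - lo - 1) : IsSaturated lo hi D := by
  intro e he hc
  by_contra hn
  have := (hD.insert_chord he hc).card_le
  rw [Finset.card_insert_of_notMem hn] at this
  omega

theorem IsApex.right_mem {lo hi : ℤ} {D : Finset (ℤ × ℤ)} (hD : IsDissection lo hi D)
    (hs : IsSaturated lo hi D) {p : ℤ × ℤ} (hp : p ∈ D) {t : ℤ} (ht : IsApex D p t) :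
    p.2 = t + 1 ∨ (t, p.2) ∈ D := by
  obtain ⟨h1, h2, h3, h4⟩ := ht
  have hpc := hD.1 p hp
  by_cases hlt : p.2 = t + 1
  · exact Or.inl hlt
  refine Or.inr (hs _ ⟨?_, ?_, hpc.2.2⟩ fun q hq => ⟨fun h => hD.2 p hp q hq ?_, fun h => ?_⟩)
  · exact hpc.1.trans h1.le
  · simp only; omega
  · exact ⟨h1.trans h.1, h.2.1, h.2.2⟩
  · obtain ⟨g1, g2, g3⟩ := h
    simp only at g1 g2 g3
    rcases lt_trichotomy q.1 p.1 with g | g | g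
    · exact hD.2 q hq p hp ⟨g, h1.trans g2, g3⟩
    · exact h4 q.2 g2 g3 (g ▸ hq)
    · rcases h3 with h3 | h3
      · omega
      · exact hD.2 _ h3 q hq ⟨g, g1, g2⟩

theorem IsSaturated.mem_whole {lo hi : ℤ} {D : Finset (ℤ × ℤ)} (hD : IsDissection lo hi D)
    (hs : IsSaturated lo hi D) (h : lo + 2 ≤ hi) : (lo, hi) ∈ D := by
  refine hs _ ⟨le_rfl, h, le_rfl⟩ fun q hq => ?_
  have := hD.1 q hq
  unfold Compat LCross
  unfold IsChord at this
  simp only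
  omega

theorem IsSaturated.le_card {lo hi : ℤ} {D : Finset (ℤ × ℤ)} (hD : IsDissection lo hi D)
    (hs : IsSaturated lo hi D) (h : lo + 2 ≤ hi) : (hi - lo - 1).toNat ≤ D.card := by
  choose! f hf using fun p (hp : p ∈ D) => exists_isApex D (hD.1 p hp).2.1
  rw [← Int.card_Ioo]
  refine Finset.card_le_card_of_surjOn f fun t ht => ?_
  simp only [Finset.coe_Ioo, Set.mem_Ioo] at ht
  obtain ⟨p, hp, hmin⟩ := Finset.exists_min_image (D.filter fun p => p.1 < t ∧ t < p.2)
    (fun p => p.2 - p.1) ⟨(lo, hi), Finset.mem_filter.2 ⟨hs.mem_whole hD h, ht⟩⟩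
  obtain ⟨hpD, hp1, hp2⟩ := Finset.mem_filter.1 hp
  have ha := hf p hpD
  refine ⟨p, hpD, ?_⟩
  rcases lt_trichotomy (f p) t with g | g | g
  · rcases ha.right_mem hD hs hpD with g' | g'
    · omega
    · have := hmin _ (Finset.mem_filter.2 ⟨g', g, hp2⟩)
      have := ha.1
      simp only at *
      omega
  · exact g
  · rcases ha.2.2.1 with g' | g'
    · omega
    · have := hmin _ (Finset.mem_filter.2 ⟨g', hp1, g⟩)
      have := ha.2.1
      simp only at *
      omega

/-- A diagonal `e` of a quadrilateral whose sides are edges or chords of `D` can only be exchanged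
for the other diagonal. -/
theorem IsDissection.quad_of_diagonal {lo hi : ℤ} {D : Finset (ℤ × ℤ)}
    (hD : IsDissection lo hi D) {e : ℤ × ℤ} (heD : e ∉ D) (hec : ∀ q ∈ D, Compat e q)
    (hex : ∀ e', IsChord lo hi e' → e' ∉ D → (∀ q ∈ D, Compat e' q) → e' ≠ e → ¬ Compat e' e)
    {i j k l : ℤ} (hij : i < j) (hjk : j < k) (hkl : k < l) (he : e = (i, k) ∨ e = (j, l))
    (hil : (i, l) ∈ D) (sij : j = i + 1 ∨ (i, j) ∈ D) (sjk : k = j + 1 ∨ (j, k) ∈ D)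
    (skl : l = k + 1 ∨ (k, l) ∈ D) :
    (∀ e', e' = (i, k) ∨ e' = (j, l) → e' ∉ D ∧ ∀ q ∈ D, Compat e' q) ∧
      ∀ e', IsChord lo hi e' → e' ∉ D → (∀ q ∈ D, Compat e' q) → e' = (i, k) ∨ e' = (j, l) := by
  have key : ∀ {x y : ℤ}, (y = x + 1 ∨ (x, y) ∈ D) → ∀ q : ℤ × ℤ, (∀ r ∈ D, Compat q r) →
      ¬ (x < q.1 ∧ q.1 < y ∧ y < q.2) ∧ ¬ (q.1 < x ∧ x < q.2 ∧ q.2 < y) := by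
    rintro x y (rfl | h) q hq
    · omega
    · exact ⟨(hq _ h).2, (hq _ h).1⟩
  have hDc : ∀ q ∈ D, ∀ r ∈ D, Compat q r := fun q hq r hr => ⟨hD.2 q hq r hr, hD.2 r hr q hq⟩
  have hnot : (i, k) ∉ D ∧ (j, l) ∉ D := by
    rcases he with rfl | rfl
    · exact ⟨heD, fun h => (hec _ h).1 ⟨hij, hjk, hkl⟩⟩
    · exact ⟨fun h => (hec _ h).2 ⟨hij, hjk, hkl⟩, heD⟩
  have cross : ∀ q : ℤ × ℤ, (∀ r ∈ D, Compat q r) → ∀ e', e' = (i, k) ∨ e' = (j, l) →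
      ¬ Compat e' q → q = (i, k) ∨ q = (j, l) := by
    intro q hq e' he' hcr
    have h1 := key sij q hq
    have h2 := key sjk q hq
    have h3 := key skl q hq
    have h4 := key (Or.inr hil) q hq
    obtain ⟨x, y⟩ := q
    simp only [Compat, LCross, Prod.mk.injEq] at *
    rcases he' with rfl | rfl <;> simp only at hcr <;> omega
  refine ⟨fun e' he' => ⟨?_, fun q hq => ?_⟩, fun e' h1 h2 h3 => ?_⟩
  · rcases he' with rfl | rfl
    exacts [hnot.1, hnot.2]
  · by_contra hcr
    rcases cross q (hDc q hq) e' he' hcr with rfl | rfl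
    exacts [hnot.1 hq, hnot.2 hq]
  · by_cases h : e' = e
    · exact h ▸ he
    · exact cross e' h3 e he fun hc => hex e' h1 h2 h3 h hc.symm

/-- A dissection missing one chord leaves exactly one quadrilateral uncut. -/
theorem IsDissection.exists_quad {lo hi : ℤ} {D : Finset (ℤ × ℤ)} (hD : IsDissection lo hi D)
    (hcard : (D.card : ℤ) = hi - lo - 2) (hw : (lo, hi) ∈ D) :
    ∃ i j k l : ℤ, i < j ∧ j < k ∧ k < l ∧ (i, l) ∈ D ∧
      (∀ e, e = (i, k) ∨ e = (j, l) → e ∉ D ∧ ∀ q ∈ D, Compat e q) ∧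
      ∀ e, IsChord lo hi e → e ∉ D → (∀ q ∈ D, Compat e q) → e = (i, k) ∨ e = (j, l) := by
  have hlh : lo + 2 ≤ hi := (hD.1 _ hw).2.1
  have hns : ¬ IsSaturated lo hi D := fun hs => by
    have := hs.le_card hD hlh
    omega
  simp only [IsSaturated, not_forall] at hns
  obtain ⟨e, he, hec, heD⟩ := hns
  have hT := hD.insert_chord he hec
  have hTs : IsSaturated lo hi (insert e D) := hT.isSaturated (by
    rw [Finset.card_insert_of_notMem heD]; push_cast; omega)
  have hex : ∀ e', IsChord lo hi e' → e' ∉ D → (∀ q ∈ D, Compat e' q) → e' ≠ e →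
      ¬ Compat e' e := by
    intro e' h1 h2 h3 h4 h5
    have := hTs e' h1 fun q hq => by
      rcases Finset.mem_insert.1 hq with rfl | hq
      exacts [h5, h3 q hq]
    exact (Finset.mem_insert.1 this).elim h4 h2
  have heT : e ∈ insert e D := Finset.mem_insert_self e D
  obtain ⟨s, hs⟩ := exists_isApex (insert e D) he.2.1
  have hs' := hs.right_mem hT hTs heT
  obtain ⟨p, hp, hmin⟩ := Finset.exists_min_image (D.filter fun p => p.1 ≤ e.1 ∧ e.2 ≤ p.2)
    (fun p => p.2 - p.1) ⟨(lo, hi), Finset.mem_filter.2 ⟨hw, he.1, he.2.2⟩⟩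
  obtain ⟨hpD, hp1, hp2⟩ := Finset.mem_filter.1 hp
  have hpT : p ∈ insert e D := Finset.mem_insert_of_mem hpD
  have hpe : p ≠ e := fun h => heD (h ▸ hpD)
  obtain ⟨t, ht⟩ := exists_isApex (insert e D) (hT.1 p hpT).2.1
  have ht' := ht.right_mem hT hTs hpT
  obtain ⟨hs1, hs2, hs3, -⟩ := hs
  obtain ⟨ht1, ht2, ht3, -⟩ := ht
  obtain ⟨x, y⟩ := e
  obtain ⟨a, b⟩ := p
  simp only [Finset.mem_insert, Prod.mk.injEq, Finset.mem_filter, and_imp, ne_eq, not_and] at *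
  have hxy : x + 2 ≤ y := he.2.1
  have s1 : s = x + 1 ∨ (x, s) ∈ D := by grind
  have s2 : y = s + 1 ∨ (s, y) ∈ D := by grind
  have hin : t ≤ x ∨ y ≤ t := by
    by_contra! hcon
    by_cases hax : a = x
    · rcases ht' with h | h | h
      · omega
      · omega
      · exact (hec _ h).1 ⟨hcon.1, hcon.2, by simp only; omega⟩
    · rcases ht3 with h | h | h
      · omega
      · omega
      · exact (hec _ h).2 ⟨by simp only; omega, hcon.1, hcon.2⟩
  rcases hin with htx | hyt
  · have hj : t = x ∧ b = y := by
      rcases ht' with h | h | h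
      · omega
      · omega
      · have := hmin _ h htx hp2
        omega
    obtain ⟨rfl, rfl⟩ := hj
    have s3 : t = a + 1 ∨ (a, t) ∈ D := by grind
    exact ⟨a, t, s, b, ht1, hs1, hs2, hpD, hD.quad_of_diagonal heD hec
      (by simpa using hex) ht1 hs1 hs2 (Or.inr rfl) hpD s3 s1 s2⟩
  · have hj : a = x ∧ t = y := by
      rcases ht3 with h | h | h
      · omega
      · omega
      · have := hmin _ h hp1 hyt
        omega
    obtain ⟨rfl, rfl⟩ := hj
    have s3 : b = t + 1 ∨ (t, b) ∈ D := by grind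
    exact ⟨a, s, t, b, hs1, hs2, ht2, hpD, hD.quad_of_diagonal heD hec
      (by simpa using hex) hs1 hs2 ht2 (Or.inl rfl) hpD s1 s2 s3⟩

/-- The translate of `p` by a multiple of `m` whose first coordinate lies in `[a, a + m)`. -/
def rep (m : ℕ) (a : ℤ) (p : ℤ × ℤ) : ℤ × ℤ :=
  (p.1 - (p.1 - a) / m * m, p.2 - (p.1 - a) / m * m)

theorem rep_fst_mem {m : ℕ} (hm : 0 < m) (a : ℤ) (p : ℤ × ℤ) :
    a ≤ (rep m a p).1 ∧ (rep m a p).1 < a + m := by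
  have h1 := Int.emod_nonneg (p.1 - a) (b := (m : ℤ)) (by omega)
  have h2 := Int.emod_lt_of_pos (p.1 - a) (b := (m : ℤ)) (by omega)
  rw [Int.emod_def, mul_comm] at h1 h2
  simp only [rep]
  omega

theorem rep_snd (m : ℕ) (a : ℤ) (p : ℤ × ℤ) : (rep m a p).2 = (rep m a p).1 + (p.2 - p.1) := by
  simp only [rep]
  ring

theorem rep_rep {m : ℕ} (hm : 0 < m) (a b : ℤ) (p : ℤ × ℤ) :
    rep m a (rep m b p) = rep m a p := by
  have : (p.1 - (p.1 - b) / m * m - a) / m = (p.1 - a) / m - (p.1 - b) / m := by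
    rw [← Int.sub_mul_ediv_right _ _ (by omega : (m : ℤ) ≠ 0)]
    congr 1
    ring
  simp only [rep, this, Prod.mk.injEq]
  constructor <;> ring

theorem rep_of_mem {m : ℕ} {a : ℤ} {p : ℤ × ℤ} (h1 : a ≤ p.1) (h2 : p.1 < a + m) :
    rep m a p = p := by
  have : (p.1 - a) / m = 0 := Int.ediv_eq_zero_of_lt (by omega) (by omega)
  simp [rep, this]

theorem IsPArc.rep_zero {m : ℕ} {p : ℤ × ℤ} (hp : IsPArc m p) : rep m 0 p = p :=
  rep_of_mem hp.1 (by simpa using hp.2.1)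

theorem IsPArc.rep_zero_rep {m : ℕ} {p : ℤ × ℤ} (hp : IsPArc m p) (hm : 0 < m) (a : ℤ) :
    rep m 0 (rep m a p) = p := by
  rw [rep_rep hm, hp.rep_zero]

theorem pcross_comm {m : ℕ} {p q : ℤ × ℤ} : PCross m p q ↔ PCross m q p := by
  have key : ∀ {p q : ℤ × ℤ}, PCross m p q → PCross m q p := by
    rintro p q ⟨k, h⟩
    refine ⟨-k, ?_⟩
    rw [neg_mul]
    omega
  exact ⟨key, key⟩

theorem pcross_rep_left {m : ℕ} {a : ℤ} {p q : ℤ × ℤ} :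
    PCross m (rep m a p) q ↔ PCross m p q := by
  constructor
  · rintro ⟨k, h⟩
    refine ⟨k - (p.1 - a) / m, ?_⟩
    simp only [rep] at h
    rw [sub_mul]
    omega
  · rintro ⟨k, h⟩
    refine ⟨k + (p.1 - a) / m, ?_⟩
    simp only [rep]
    rw [add_mul]
    omega

theorem pcross_rep_right {m : ℕ} {a : ℤ} {p q : ℤ × ℤ} :
    PCross m p (rep m a q) ↔ PCross m p q := by
  rw [pcross_comm, pcross_rep_left, pcross_comm]

theorem permitted_rep {m : ℕ} {c : ZMod m → Bool} {a : ℤ} {p : ℤ × ℤ} :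
    Permitted m c (rep m a p) ↔ Permitted m c p := by
  simp [Permitted, rep]

/-- An arc crosses the maximal arc at `b` if and only if it separates `b` from the puncture. -/
theorem pcross_loop_iff {m : ℕ} {q : ℤ × ℤ} (hq : q.2 ≤ q.1 + m) (b : ℤ) :
    PCross m q (b, b + m) ↔ ∃ k : ℤ, q.1 + k * m < b ∧ b < q.2 + k * m := by
  constructor
  · rintro ⟨k, h | h⟩
    · exact ⟨k, h.1, h.2.1⟩
    · refine ⟨k - 1, ?_⟩
      simp only at h
      rw [sub_mul]
      omega
  · rintro ⟨k, h⟩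
    refine ⟨k, Or.inl ⟨h.1, h.2, ?_⟩⟩
    simp only
    omega

theorem mul_trichotomy (m : ℕ) (k : ℤ) : k * m = 0 ∨ (m : ℤ) ≤ k * m ∨ k * m ≤ -m := by
  rcases lt_trichotomy k 0 with h | rfl | h
  · right; right; nlinarith
  · simp
  · right; left; nlinarith

theorem not_pcross_self {m : ℕ} {p : ℤ × ℤ} (hp : IsPArc m p) : ¬ PCross m p p := by
  rintro ⟨k, h⟩
  obtain ⟨-, -, h1, h2⟩ := hp
  have := mul_trichotomy m k
  omega

theorem pcross_iff_not_compat {m : ℕ} {a : ℤ} {p q : ℤ × ℤ} (hp : IsChord a (a + m) p)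
    (hq : IsChord a (a + m) q) : PCross m p q ↔ ¬ Compat p q := by
  unfold IsChord at hp hq
  unfold Compat LCross
  constructor
  · rintro ⟨k, h⟩
    have := mul_trichotomy m k
    omega
  · intro h
    refine ⟨0, ?_⟩
    rw [zero_mul]
    omega

theorem loop_isPArc {m : ℕ} (hm : 2 ≤ m) {a : ℤ} (h0 : 0 ≤ a) (h1 : a < m) :
    IsPArc m (a, a + m) :=
  ⟨h0, h1, by simpa using hm, le_rfl⟩

theorem loop_eq_of_not_pcross {m : ℕ} {a b : ℤ} (ha : 0 ≤ a) (ha' : a < m) (hb : 0 ≤ b)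
    (hb' : b < m) (h : ¬ PCross m (a, a + m) (b, b + m)) : a = b := by
  rw [pcross_loop_iff le_rfl] at h
  push Not at h
  have h0 := h 0
  have h1 := h (-1)
  simp only [zero_mul, neg_mul, one_mul] at h0 h1
  omega

theorem IsPArc.isChord_rep {m : ℕ} {p : ℤ × ℤ} (hp : IsPArc m p) {a : ℤ}
    (h : ¬ PCross m p (a, a + m)) : IsChord a (a + m) (rep m a p) := by
  obtain ⟨h1, h2, h3, h4⟩ := hp
  have hm : 0 < m := by omega
  have hr := rep_fst_mem hm a p
  have hs := rep_snd m a p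
  refine ⟨hr.1, by omega, ?_⟩
  by_contra hcon
  refine h (pcross_rep_left.1 (show PCross m (rep m a p) _ from ⟨0, Or.inr ?_⟩))
  simp only [zero_mul]
  omega

theorem isPArc_rep_zero {m : ℕ} (hm : 0 < m) {p : ℤ × ℤ} (h1 : p.1 + 2 ≤ p.2)
    (h2 : p.2 ≤ p.1 + m) : IsPArc m (rep m 0 p) := by
  have hr := rep_fst_mem hm 0 p
  have hs := rep_snd m 0 p
  unfold IsPArc
  omega

/-- Some maximal arc is compatible with any given set of pairwise non-crossing arcs. -/
theorem exists_loop {m : ℕ} (hm : 2 ≤ m) {S : Finset (ℤ × ℤ)} (hS : ∀ p ∈ S, IsPArc m p)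
    (hc : ∀ p ∈ S, ∀ q ∈ S, ¬ PCross m p q) :
    ∃ a : ℤ, 0 ≤ a ∧ a < m ∧ ∀ p ∈ S, ¬ PCross m p (a, a + m) := by
  rcases S.eq_empty_or_nonempty with rfl | hne
  · exact ⟨0, le_rfl, by omega, by simp⟩
  obtain ⟨p, hp, hmax⟩ := Finset.exists_max_image S (fun p => p.2 - p.1) hne
  refine ⟨p.1, (hS p hp).1, (hS p hp).2.1, fun q hq h => ?_⟩
  obtain ⟨k, h1, h2⟩ := (pcross_loop_iff (hS q hq).2.2.2 _).1 h
  have := hmax q hq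
  refine hc q hq p hp ⟨k, Or.inl ⟨h1, h2, ?_⟩⟩
  omega

/-- Cutting along a compatible maximal arc turns non-crossing arcs into a polygon dissection. -/
theorem isDissection_image {m : ℕ} {S : Finset (ℤ × ℤ)}
    (hS : ∀ p ∈ S, IsPArc m p) (hc : ∀ p ∈ S, ∀ q ∈ S, ¬ PCross m p q) {a : ℤ}
    (ha : ∀ p ∈ S, ¬ PCross m p (a, a + m)) :
    IsDissection a (a + m) (S.image (rep m a)) := by
  simp only [IsDissection, Finset.forall_mem_image]
  have hch := fun p hp => (hS p hp).isChord_rep (ha p hp)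
  refine ⟨hch, fun p hp q hq h => hc p hp q hq ?_⟩
  rw [← pcross_rep_left (a := a), ← pcross_rep_right (a := a),
    pcross_iff_not_compat (hch p hp) (hch q hq)]
  exact fun h' => h'.1 h

theorem card_image_rep {m : ℕ} (hm : 0 < m) {S : Finset (ℤ × ℤ)} (hS : ∀ p ∈ S, IsPArc m p)
    (a : ℤ) : (S.image (rep m a)).card = S.card :=
  Finset.card_image_of_injOn fun p hp q hq h => by
    rw [← (hS p hp).rep_zero_rep hm a, h, (hS q hq).rep_zero_rep hm a]

theorem card_le_of_noncrossing {m : ℕ} (hm : 2 ≤ m) {S : Finset (ℤ × ℤ)}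
    (hS : ∀ p ∈ S, IsPArc m p) (hc : ∀ p ∈ S, ∀ q ∈ S, ¬ PCross m p q) : S.card ≤ m - 1 := by
  obtain ⟨a, -, -, ha⟩ := exists_loop hm hS hc
  have := (isDissection_image hS hc ha).card_le
  rw [card_image_rep (by omega) hS] at this
  omega

theorem noncrossing_insert {m : ℕ} {S : Finset (ℤ × ℤ)}
    (hc : ∀ p ∈ S, ∀ q ∈ S, ¬ PCross m p q) {e : ℤ × ℤ} (he : IsPArc m e)
    (hec : ∀ q ∈ S, ¬ PCross m q e) :
    ∀ p ∈ insert e S, ∀ q ∈ insert e S, ¬ PCross m p q := by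
  simp only [Finset.forall_mem_insert]
  exact ⟨⟨not_pcross_self he, fun q hq h => hec q hq (pcross_comm.1 h)⟩,
    fun p hp => ⟨hec p hp, hc p hp⟩⟩

/-- The case of a set of `m - 2` arcs containing a maximal arc. -/
theorem completions_of_loop_mem {m : ℕ} (hm : 2 ≤ m) {c : ZMod m → Bool} {S : Finset (ℤ × ℤ)}
    (hcard : S.card = m - 2) (hS : ∀ p ∈ S, IsPArc m p) (hperm : ∀ p ∈ S, Permitted m c p)
    (hc : ∀ p ∈ S, ∀ q ∈ S, ¬ PCross m p q) {a : ℤ} (haS : (a, a + (m : ℤ)) ∈ S) :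
    (∃ e, e ∉ S ∧ IsPArc m e ∧ Permitted m c e ∧ ∀ q ∈ S, ¬ PCross m q e) ∧
      ∃ u v, ∀ e, e ∉ S → IsPArc m e → (∀ q ∈ S, ¬ PCross m q e) → e = u ∨ e = v := by
  have hm0 : 0 < m := by omega
  have ha : ∀ p ∈ S, ¬ PCross m p (a, a + m) := fun p hp => hc p hp _ haS
  have hD := isDissection_image hS hc ha
  have hDcard := card_image_rep hm0 hS a
  have hpos := Finset.card_pos.2 ⟨_, haS⟩
  have hrep : ∀ e, rep m 0 e ∈ S → IsChord a (a + m) e → e ∈ S.image (rep m a) := by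
    intro e he hch
    refine Finset.mem_image.2 ⟨_, he, ?_⟩
    have := hch.2
    rw [rep_rep hm0, rep_of_mem hch.1 (by omega)]
  have hw : (a, a + (m : ℤ)) ∈ S.image (rep m a) :=
    Finset.mem_image.2 ⟨_, haS, rep_of_mem le_rfl (by simp only; omega)⟩
  obtain ⟨i, j, k, l, hij, hjk, hkl, hil, hquad, honly⟩ := hD.exists_quad (by omega) hw
  have hilc := hD.1 _ hil
  refine ⟨?_, rep m 0 (i, k), rep m 0 (j, l), fun e heS he hec => ?_⟩
  · have hilp : Permitted m c (i, l) := by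
      obtain ⟨p, hp, hpe⟩ := Finset.mem_image.1 hil
      exact hpe ▸ permitted_rep.2 (hperm p hp)
    obtain ⟨e, he, hep⟩ : ∃ e, (e = (i, k) ∨ e = (j, l)) ∧ Permitted m c e := by
      rcases hilp with h | h
      · exact ⟨_, Or.inl rfl, Or.inl h⟩
      · exact ⟨_, Or.inr rfl, Or.inr h⟩
    have hch : IsChord a (a + m) e := by
      unfold IsChord at *
      rcases he with rfl | rfl <;> simp only at * <;> omega
    have hlen : e.2 ≤ e.1 + m := by have := hch.1; have := hch.2.2; omega
    obtain ⟨h1, h2⟩ := hquad e he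
    refine ⟨rep m 0 e, fun h => h1 (hrep e h hch), isPArc_rep_zero hm0 hch.2.1 hlen,
      permitted_rep.2 hep, fun q hq h => ?_⟩
    have hqD := Finset.mem_image_of_mem (rep m a) hq
    rw [pcross_rep_right, ← pcross_rep_left (a := a), pcross_comm,
      pcross_iff_not_compat hch (hD.1 _ hqD)] at h
    exact h (h2 _ hqD)
  · have hch : IsChord a (a + m) (rep m a e) :=
      he.isChord_rep fun h => hec _ haS (pcross_comm.1 h)
    have := honly (rep m a e) hch (fun h => ?_) ?_
    · rw [← he.rep_zero_rep hm0 a]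
      exact this.imp (congrArg _) (congrArg _)
    · obtain ⟨p, hp, hpe⟩ := Finset.mem_image.1 h
      rw [← he.rep_zero_rep hm0 a, ← hpe, (hS p hp).rep_zero_rep hm0 a] at heS
      exact heS hp
    · simp only [Finset.forall_mem_image]
      intro q hq
      by_contra hcon
      rw [← pcross_iff_not_compat hch (hD.1 _ (Finset.mem_image_of_mem _ hq)),
        pcross_rep_left, pcross_rep_right, pcross_comm] at hcon
      exact hec q hq hcon

/-- The case of a set of `m - 2` arcs containing no maximal arc: the puncture lies in a digon. -/
theorem completions_of_loop_notMem {m : ℕ} (hm : 2 ≤ m) {c : ZMod m → Bool}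
    (hblue : ∃ v, c v = true) {S : Finset (ℤ × ℤ)}
    (hcard : S.card = m - 2) (hS : ∀ p ∈ S, IsPArc m p) (hperm : ∀ p ∈ S, Permitted m c p)
    (hc : ∀ p ∈ S, ∀ q ∈ S, ¬ PCross m p q) {a : ℤ} (ha0 : 0 ≤ a) (ham : a < m)
    (ha : ∀ p ∈ S, ¬ PCross m p (a, a + m)) (haS : (a, a + (m : ℤ)) ∉ S) :
    (∃ e, e ∉ S ∧ IsPArc m e ∧ Permitted m c e ∧ ∀ q ∈ S, ¬ PCross m q e) ∧
      ∃ u v, ∀ e, e ∉ S → IsPArc m e → (∀ q ∈ S, ¬ PCross m q e) → e = u ∨ e = v := by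
  have hm0 : 0 < m := by omega
  have hloop := loop_isPArc hm ha0 ham
  have hS' : ∀ p ∈ insert (a, a + (m : ℤ)) S, IsPArc m p := by
    simpa only [Finset.forall_mem_insert] using ⟨hloop, hS⟩
  have hD := isDissection_image (a := a) hS' (noncrossing_insert hc hloop ha) (by
    simpa only [Finset.forall_mem_insert] using ⟨not_pcross_self hloop, ha⟩)
  have hDcard := card_image_rep hm0 hS' a
  rw [Finset.card_insert_of_notMem haS] at hDcard
  have hsat := hD.isSaturated (by omega)
  have hwr : rep m a (a, a + (m : ℤ)) = (a, a + m) := rep_of_mem le_rfl (by simp only; omega)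
  have hw := hsat.mem_whole hD (by omega)
  obtain ⟨j, hj⟩ := exists_isApex _ (hD.1 _ hw).2.1
  have hjr := hj.right_mem hD hsat hw
  obtain ⟨haj, hjm, hjl, -⟩ := hj
  have hback : ∀ e ∈ (insert (a, a + (m : ℤ)) S).image (rep m a), e ≠ (a, a + (m : ℤ)) →
      ∃ p ∈ S, rep m a p = e := by
    intro e he hne
    obtain ⟨p, hp, hpe⟩ := Finset.mem_image.1 he
    rcases Finset.mem_insert.1 hp with rfl | hp
    · exact (hne (hpe ▸ hwr)).elim
    · exact ⟨p, hp, hpe⟩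
  have noLoop : ∀ b : ℤ, (b, b + (m : ℤ)) ∉ S := by
    intro b hb
    have := loop_eq_of_not_pcross (hS _ hb).1 (hS _ hb).2.1 ha0 ham (ha _ hb)
    exact haS (this ▸ hb)
  simp only at haj hjm hjl hjr
  refine ⟨?_, (a, a + m), rep m 0 (j, j + m), fun e heS he hec => ?_⟩
  · by_cases hca : c (a : ZMod m) = true
    · exact ⟨_, haS, hloop, Or.inl hca, ha⟩
    have hcj : c (j : ZMod m) = true := by
      rcases hjl with h1 | h1
      · rcases hjr with h2 | h2
        · obtain rfl : m = 2 := by omega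
          obtain ⟨v, hv⟩ := hblue
          subst h1
          have : v = (a : ZMod 2) ∨ v = ((a + 1 : ℤ) : ZMod 2) := by
            push_cast
            generalize (a : ZMod 2) = x
            clear hv
            revert v x
            decide
          rcases this with rfl | rfl
          exacts [(hca hv).elim, hv]
        · obtain ⟨p, hp, hpe⟩ := hback _ h2 (by simp only [ne_eq, Prod.mk.injEq]; omega)
          have := (permitted_rep (a := a)).2 (hperm p hp)
          rw [hpe] at this
          exact this.resolve_right (by simpa using hca)
      · obtain ⟨p, hp, hpe⟩ := hback _ h1 (by simp only [ne_eq, Prod.mk.injEq]; omega)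
        have := (permitted_rep (a := a)).2 (hperm p hp)
        rw [hpe] at this
        exact this.resolve_left hca
    refine ⟨rep m 0 (j, j + m), ?_, isPArc_rep_zero hm0 (by simpa using hm) le_rfl,
      permitted_rep.2 (Or.inl hcj), fun q hq h => ?_⟩
    · have := rep_snd m 0 (j, j + m)
      simp only [add_sub_cancel_left] at this
      rw [← Prod.mk.eta (p := rep m 0 (j, j + (m : ℤ))), this]
      exact noLoop _
    · have hqD : rep m a q ∈ (insert (a, a + (m : ℤ)) S).image (rep m a) :=
        Finset.mem_image_of_mem _ (Finset.mem_insert_of_mem hq)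
      have hqc := hD.1 _ hqD
      have hql := fun p hp => hD.2 p hp _ hqD
      have hqr := hD.2 _ hqD
      have hq0 := (hS q hq).rep_zero_rep hm0 a
      rw [pcross_rep_right, ← pcross_rep_left (a := a)] at h
      generalize rep m a q = r at *
      obtain ⟨h1, h2, h3⟩ := hqc
      obtain ⟨k, hk⟩ := (pcross_loop_iff (by omega) _).1 h
      have hk' : r.1 < j ∧ j < r.2 := by
        have := mul_trichotomy m k
        omega
      have e1 : r.1 = a := by
        rcases hjl with g | g
        · omega
        · by_contra hne
          exact hql _ g ⟨by simp only; omega, hk'.1, hk'.2⟩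
      have e2 : r.2 = a + m := by
        rcases hjr with g | g
        · omega
        · by_contra hne
          exact hqr _ g ⟨hk'.1, hk'.2, by simp only; omega⟩
      rw [← Prod.mk.eta (p := r), e1, e2, hloop.rep_zero] at hq0
      exact haS (hq0 ▸ hq)
  · have hT : ∀ p ∈ insert e S, IsPArc m p := by
      simpa only [Finset.forall_mem_insert] using ⟨he, hS⟩
    have hTc := noncrossing_insert hc he hec
    obtain ⟨b, hb0, hbm, hb⟩ := exists_loop hm hT hTc
    have hbl := loop_isPArc hm hb0 hbm
    have hbT : (b, b + (m : ℤ)) ∈ insert e S := by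
      by_contra hn
      have := card_le_of_noncrossing hm
        ((Finset.forall_mem_insert _ _ _).2 ⟨hbl, hT⟩)
        (noncrossing_insert hTc hbl hb)
      rw [Finset.card_insert_of_notMem hn, Finset.card_insert_of_notMem heS] at this
      omega
    have hbe := (Finset.mem_insert.1 hbT).resolve_right (noLoop b)
    have hr := rep_fst_mem hm0 a e
    have hs := rep_snd m a e
    have hlen : e.2 - e.1 = m := by rw [← hbe]; simp
    rw [hlen] at hs
    have hside : ∀ x y : ℤ, (x, y) ∈ (insert (a, a + (m : ℤ)) S).image (rep m a) →
        (x, y) ≠ (a, a + (m : ℤ)) → ¬ (x < (rep m a e).1 ∧ (rep m a e).1 < y) := by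
      intro x y hxy hne hcon
      obtain ⟨p, hp, hpe⟩ := hback _ hxy hne
      obtain ⟨g1, g2, g3⟩ := hD.1 _ hxy
      simp only at g1 g2 g3
      refine hec p hp ?_
      rw [← pcross_rep_left (a := a), ← pcross_rep_right (a := a), hpe]
      refine ⟨0, Or.inl ?_⟩
      simp only [zero_mul]
      omega
    have hfst : (rep m a e).1 = a ∨ (rep m a e).1 = j := by
      by_contra! hcon
      by_cases hlt : (rep m a e).1 < j
      · rcases hjl with g | g
        · omega
        · refine hside _ _ g ?_ ⟨by omega, hlt⟩
          simp only [ne_eq, Prod.mk.injEq]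
          omega
      · rcases hjr with g | g
        · omega
        · refine hside _ _ g ?_ ⟨by omega, hr.2⟩
          simp only [ne_eq, Prod.mk.injEq]
          omega
    rw [← he.rep_zero_rep hm0 a, ← Prod.mk.eta (p := rep m a e), hs]
    rcases hfst with h | h
    · exact Or.inl (by rw [h, hloop.rep_zero])
    · exact Or.inr (by rw [h])

/-- For any non-trivial bicolouring of `P*_m` (`m ≥ 2`), every set of
`m - 2` pairwise non-crossing permitted arcs is contained in at least one and at most
two permissible triangulations. -/
theorem codim_one_in_one_or_two (m : ℕ) (hm : 2 ≤ m) (c : ZMod m → Bool)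
    (hc : IsNontrivialBicolouring m c)
    (S : Finset (ℤ × ℤ)) (hScard : S.card = m - 2)
    (hSarc : ∀ p ∈ S, IsPArc m p ∧ Permitted m c p)
    (hScross : ∀ p ∈ S, ∀ q ∈ S, p ≠ q → ¬ PCross m p q) :
    (∃ T : Finset (ℤ × ℤ), IsPermissible m c T ∧ S ⊆ T) ∧
      ∀ T₁ T₂ T₃ : Finset (ℤ × ℤ),
        IsPermissible m c T₁ → S ⊆ T₁ →
        IsPermissible m c T₂ → S ⊆ T₂ →
        IsPermissible m c T₃ → S ⊆ T₃ →
        T₁ = T₂ ∨ T₁ = T₃ ∨ T₂ = T₃ := by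
  have hm0 : 0 < m := by omega
  have hS := fun p hp => (hSarc p hp).1
  have hperm := fun p hp => (hSarc p hp).2
  have hcr : ∀ p ∈ S, ∀ q ∈ S, ¬ PCross m p q := by
    intro p hp q hq
    by_cases h : p = q
    · exact h ▸ not_pcross_self (hS p hp)
    · exact hScross p hp q hq h
  obtain ⟨a, ha0, ham, ha⟩ := exists_loop hm hS hcr
  obtain ⟨⟨e, heS, he, hep, hec⟩, u, v, huv⟩ :
      (∃ e, e ∉ S ∧ IsPArc m e ∧ Permitted m c e ∧ ∀ q ∈ S, ¬ PCross m q e) ∧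
        ∃ u v, ∀ e, e ∉ S → IsPArc m e → (∀ q ∈ S, ¬ PCross m q e) → e = u ∨ e = v := by
    by_cases haS : (a, a + (m : ℤ)) ∈ S
    · exact completions_of_loop_mem hm hScard hS hperm hcr haS
    · exact completions_of_loop_notMem hm hc.1.1 hScard hS hperm hcr ha0 ham ha haS
  constructor
  · refine ⟨insert e S, ⟨⟨?_, ?_, ?_⟩, ?_⟩, Finset.subset_insert e S⟩
    · rw [Finset.card_insert_of_notMem heS]
      omega
    · simpa only [Finset.forall_mem_insert] using ⟨he, hS⟩
    · exact fun p hp q hq _ => noncrossing_insert hcr he hec p hp q hq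
    · simpa only [Finset.forall_mem_insert] using ⟨hep, hperm⟩
  · have key : ∀ T, IsPermissible m c T → S ⊆ T → T = insert u S ∨ T = insert v S := by
      rintro T ⟨⟨hTcard, hT, hTc⟩, -⟩ hST
      obtain ⟨e, heS, rfl⟩ := Finset.exists_eq_insert_iff.2 ⟨hST, by omega⟩
      have heT := Finset.mem_insert_self e S
      have := huv e heS (hT e heT) fun q hq =>
        hTc q (hST hq) e heT fun h => heS (h ▸ hq)
      exact this.imp (fun h => by rw [h]) (fun h => by rw [h])
    intro T₁ T₂ T₃ h₁ s₁ h₂ s₂ h₃ s₃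
    rcases key T₁ h₁ s₁ with rfl | rfl <;> rcases key T₂ h₂ s₂ with rfl | rfl <;>
      rcases key T₃ h₃ s₃ with rfl | rfl <;> simp

end Punc
end
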